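/- Composite i.i.d. null versus composite i.i.d. alternative. Let ℋ = ℂ^d be a finite-dimensional Hilbert space and 𝒜₁, ℬ₁ ⊆ 𝒟(ℋ) two non-empty closed sets of states. Then Stein(𝒜₁^{iid}‖ℬ₁^{iid}) = min*_{μ∈𝒫(ℬ₁)} lim_{n→∞} (1/n) inf_{ρ∈𝒜₁} D(ρ^{⊗n} ‖ ∫_{ℬ₁} dμ(σ) σ^{⊗n}), where the minimum is restricted to those μ for which the inner limit in n exists (a non-empty set on which the minimum is attained). -/

import Mathlib

open Filter MeasureTheory Topology
open scoped BigOperators Classical ComplexOrder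

noncomputable section

namespace QSanov

/-- Matrices representing operators on the single-copy Hilbert space with orthonormal
basis indexed by `ι`. -/
abbrev MatC (ι : Type*) := Matrix ι ι ℂ

/-- Matrices representing operators on the `n`-fold tensor power Hilbert space. -/
abbrev MatN (ι : Type*) (n : ℕ) := Matrix (Fin n → ι) (Fin n → ι) ℂ

instance matMeasurableSpace (m n : Type*) : MeasurableSpace (Matrix m n ℂ) :=
  inferInstanceAs (MeasurableSpace (m → n → ℂ))

/-- A quantum state: a positive semidefinite matrix of trace one. -/
def IsState {κ : Type*} [Fintype κ] (ρ : Matrix κ κ ℂ) : Prop :=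
  ρ.PosSemidef ∧ ρ.trace = 1

/-- Loewner order: `A ≤ B` iff `B - A` is positive semidefinite. -/
def loewnerLE {κ : Type*} [Fintype κ] (A B : Matrix κ κ ℂ) : Prop :=
  (B - A).PosSemidef

/-- The `n`-fold tensor power `ρ^{⊗n}` of a single-copy matrix. -/
def tensorPow {ι : Type*} (ρ : MatC ι) (n : ℕ) : MatN ι n :=
  fun i j => ∏ k, ρ (i k) (j k)

/-- The tensor product `ρ₁ ⊗ ⋯ ⊗ ρ_n` of a family of single-copy matrices. -/
def tensorProdFam {ι : Type*} {n : ℕ} (ρ : Fin n → MatC ι) : MatN ι n :=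
  fun i j => ∏ k, ρ k (i k) (j k)

/-- The tensor product of an `n`-copy matrix and an `m`-copy matrix. -/
def tensorMul {ι : Type*} {n m : ℕ} (ρ : MatN ι n) (σ : MatN ι m) : MatN ι (n + m) :=
  fun i j => ρ (fun t => i (Fin.castAdd m t)) (fun t => j (Fin.castAdd m t)) *
    σ (fun t => i (Fin.natAdd n t)) (fun t => j (Fin.natAdd n t))

/-- Conjugation `U_π ρ U_π†` by the unitary permuting the `n` tensor factors. -/
def permCopies {ι : Type*} {n : ℕ} (π : Equiv.Perm (Fin n)) (ρ : MatN ι n) : MatN ι n :=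
  fun i j => ρ (i ∘ π) (j ∘ π)

/-- Matrix logarithm via functional calculus on the support (eigenvalue `0` is sent
to `0`, since `Real.log 0 = 0`). -/
def matLog {κ : Type*} [Fintype κ] [DecidableEq κ] (A : Matrix κ κ ℂ) : Matrix κ κ ℂ :=
  if hA : A.IsHermitian then
    (hA.eigenvectorUnitary : Matrix κ κ ℂ) *
      (Matrix.diagonal fun i => (Real.log (hA.eigenvalues i) : ℂ)) *
      (star (hA.eigenvectorUnitary : Matrix κ κ ℂ))
  else 0

/-- Support inclusion `supp ρ ⊆ supp σ`, phrased as inclusion of ranges. -/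
def suppLE {κ : Type*} [Fintype κ] [DecidableEq κ] (ρ σ : Matrix κ κ ℂ) : Prop :=
  LinearMap.range (Matrix.toLin' ρ) ≤ LinearMap.range (Matrix.toLin' σ)

/-- Umegaki relative entropy `D(ρ‖σ) = Tr[ρ (log ρ - log σ)]`, equal to `+∞` when
`supp ρ ⊄ supp σ`. -/
def relEnt {κ : Type*} [Fintype κ] [DecidableEq κ] (ρ σ : Matrix κ κ ℂ) : EReal :=
  if suppLE ρ σ then (((ρ * (matLog ρ - matLog σ)).trace.re : ℝ) : EReal) else ⊤

/-- Relative entropy between two sets of states: `D(𝒜‖ℬ) = inf_{ρ∈𝒜, σ∈ℬ} D(ρ‖σ)`. -/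
def relEntSet {κ : Type*} [Fintype κ] [DecidableEq κ] (A B : Set (Matrix κ κ ℂ)) : EReal :=
  ⨅ ρ ∈ A, ⨅ σ ∈ B, relEnt ρ σ

/-- The composite i.i.d. hypothesis `𝒻₁^{⊗n, iid}` built on the base set `F1`. -/
def iidSet {ι : Type*} (F1 : Set (MatC ι)) (n : ℕ) : Set (MatN ι n) :=
  {ρ | ∃ σ ∈ F1, ρ = tensorPow σ n}

/-- The arbitrarily varying hypothesis `𝒻₁^{⊗n, av}` built on the base set `F1`. -/
def avSet {ι : Type*} (F1 : Set (MatC ι)) (n : ℕ) : Set (MatN ι n) :=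
  {ρ | ∃ f : Fin n → MatC ι, (∀ p, f p ∈ F1) ∧ ρ = tensorProdFam f}

/-- Worst-case type II error probability `β_ε(A‖B)` for a threshold `ε` on the
worst-case type I error probability. -/
def typeII {κ : Type*} [Fintype κ] [DecidableEq κ] (A B : Set (Matrix κ κ ℂ)) (ε : ℝ) : ℝ :=
  sInf {b : ℝ | ∃ E : Matrix κ κ ℂ, E.PosSemidef ∧ (1 - E).PosSemidef ∧
    (∀ ρ ∈ A, (ρ * (1 - E)).trace.re ≤ ε) ∧
    b = sSup {x : ℝ | ∃ σ ∈ B, x = (σ * E).trace.re}}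

/-- `- log x`, with value `+∞` for `x ≤ 0`. -/
def negLog (x : ℝ) : EReal := if x ≤ 0 then ⊤ else ((-Real.log x : ℝ) : EReal)

/-- `(1/n : EReal)`. -/
def cFrac (n : ℕ) : EReal := (((n : ℝ)⁻¹ : ℝ) : EReal)

/-- The Stein exponent `Stein(𝒜‖ℬ) = lim_{ε→0⁺} liminf_n -(1/n) log β_ε(𝒜_n‖ℬ_n)`;
since the inner quantity is monotone nondecreasing in `ε`, the limit as `ε → 0⁺`
coincides with the infimum over `ε ∈ (0,1)`. -/
def steinExponent {ι : Type*} [Fintype ι] [DecidableEq ι]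
    (A B : ∀ n : ℕ, Set (MatN ι n)) : EReal :=
  ⨅ ε ∈ Set.Ioo (0 : ℝ) 1,
    Filter.liminf (fun n : ℕ => cFrac n * negLog (typeII (A n) (B n) ε)) Filter.atTop

/-- The mixture `∫ dμ(σ) σ^{⊗n}` of i.i.d. states along a measure `μ` on a set of
states `C` (Bochner integral, computed entrywise). -/
def iidMix {ι : Type*} {C : Set (MatC ι)} (μ : Measure ↥C) (n : ℕ) : MatN ι n :=
  fun i j => ∫ σ, (∏ k, (σ : MatC ι) (i k) (j k)) ∂μ

/-- The `b`-th block of size `k` of an index of `ℋ^{⊗ mk}`. -/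
def blockOf {ι : Type*} {m k : ℕ} (i : Fin (m * k) → ι) (b : Fin m) : Fin k → ι :=
  fun t => i (finProdFinEquiv (b, t))

/-- Replace the blocks in `S` of the index `i` by the values prescribed by `c`. -/
def mergeBlocks {ι : Type*} {m k : ℕ} (S : Finset (Fin m)) (c : Fin m → Fin k → ι)
    (i : Fin (m * k) → ι) : Fin (m * k) → ι :=
  fun p => if (finProdFinEquiv.symm p).1 ∈ S
    then c (finProdFinEquiv.symm p).1 (finProdFinEquiv.symm p).2 else i p

/-- Entry `(i,j)` of the partial trace of `ρ` over the blocks in `S`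
(the remaining blocks being evaluated at `i`, `j`). -/
def blockPartialTrace {ι : Type*} [Fintype ι] {m k : ℕ} (S : Finset (Fin m))
    (ρ : MatN ι (m * k)) (i j : Fin (m * k) → ι) : ℂ :=
  (((Fintype.card ι : ℂ) ^ (k * (m - S.card)))⁻¹) *
    ∑ c : Fin m → Fin k → ι, ρ (mergeBlocks S c i) (mergeBlocks S c j)

/-- The `m`-fold tensor power `(𝒩^δ_ω)^{⊗ m}` of the depolarising channel
`𝒩^δ_ω(X) = (1-δ) X + δ Tr[X] ω`, acting blockwise on blocks of `k` tensor factors. -/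
def blockDepolarize {ι : Type*} [Fintype ι] (δ : ℝ) {k : ℕ} (ω : MatN ι k) (m : ℕ)
    (ρ : MatN ι (m * k)) : MatN ι (m * k) :=
  fun i j => ∑ S : Finset (Fin m),
    (((1 - δ) ^ (m - S.card) * δ ^ S.card : ℝ) : ℂ) *
      ((∏ b ∈ S, ω (blockOf i b) (blockOf j b)) * blockPartialTrace S ρ i j)

/-- The `m`-fold tensor power of a `k`-copy matrix, as an `mk`-copy matrix. -/
def powBlocks {ι : Type*} {k : ℕ} (ρ : MatN ι k) (m : ℕ) : MatN ι (m * k) :=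
  fun i j => ∏ b : Fin m, ρ (blockOf i b) (blockOf j b)

/-- `Tr_{n+1,…,n+k}[ρ (𝟙^{⊗n} ⊗ F)]`, the filtered reduction of an `(n+k)`-copy matrix. -/
def condReduce {ι : Type*} [Fintype ι] {n k : ℕ} (ρ : MatN ι (n + k)) (F : MatN ι k) :
    MatN ι n :=
  fun i j => ∑ a : Fin k → ι, ∑ b : Fin k → ι,
    ρ (Fin.append i a) (Fin.append j b) * F b a

/-- Partial trace over the `k`-th tensor factor. -/
def traceOutAt {ι : Type*} [Fintype ι] {n : ℕ} (k : Fin (n + 1)) (σ : MatN ι (n + 1)) :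
    MatN ι n :=
  fun i j => ∑ a : ι, σ (k.insertNth a i) (k.insertNth a j)

/-- Insert the single-copy state `τ` at position `k` into an `n`-copy matrix. -/
def insertState {ι : Type*} {n : ℕ} (k : Fin (n + 1)) (τ : MatC ι) (σ : MatN ι n) :
    MatN ι (n + 1) :=
  fun i j => τ (i k) (j k) *
    σ (fun t => i (k.succAbove t)) (fun t => j (k.succAbove t))

/-- Product of a state on `A^n` and a state on `B^n`, viewed as a state on
`(ℋ_A ⊗ ℋ_B)^{⊗ n}` (reordering tensor factors implicitly). -/
def prodStateAB {ιA ιB : Type*} {n : ℕ} (α : Matrix (Fin n → ιA) (Fin n → ιA) ℂ)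
    (β : Matrix (Fin n → ιB) (Fin n → ιB) ℂ) : MatN (ιA × ιB) n :=
  fun i j => α (fun k => (i k).1) (fun k => (j k).1) * β (fun k => (i k).2) (fun k => (j k).2)


/-- The set `𝒮_{A^n:B^n}` of separable states across the cut `A^n : B^n`. -/
def sepSet (ιA ιB : Type*) [Fintype ιA] [Fintype ιB] (n : ℕ) : Set (MatN (ιA × ιB) n) :=
  convexHull ℝ {ρ | ∃ α β, IsState α ∧ IsState β ∧ ρ = prodStateAB α β}

/-- Classical relative entropy of two finitely supported output distributions. -/
def clRelEnt {m : ℕ} (P Q : Fin m → ℝ) : EReal :=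
  ∑ x, (if P x = 0 then (0 : EReal) else if Q x = 0 then (⊤ : EReal)
    else ((P x * Real.log (P x / Q x) : ℝ) : EReal))

/-- Measured relative entropy: supremum over all finite POVMs of the classical
relative entropy of the induced outcome distributions. -/
def measuredRelEnt {κ : Type*} [Fintype κ] [DecidableEq κ] (ρ σ : Matrix κ κ ℂ) : EReal :=
  ⨆ (m : ℕ) (E : Fin m → Matrix κ κ ℂ) (_ : ∀ x, (E x).PosSemidef) (_ : ∑ x, E x = 1),
    clRelEnt (fun x => (ρ * E x).trace.re) (fun x => (σ * E x).trace.re)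


/-- Axiom Q.I: there is a full-support free state `τ ∈ 𝒜₁` such that every `𝒜_{mk}`
is stable under blockwise depolarising towards `τ^{⊗k}`. -/
def AxiomQI {ι : Type*} [Fintype ι] [DecidableEq ι] (A : ∀ n : ℕ, Set (MatN ι n)) : Prop :=
  ∃ τ : MatC ι, tensorPow τ 1 ∈ A 1 ∧
    ∀ m k : ℕ, 1 ≤ m → 1 ≤ k → ∀ ρ ∈ A (m * k),
      suppLE ρ (tensorPow τ (m * k)) ∧
      ∀ δ ∈ Set.Icc (0 : ℝ) 1, blockDepolarize δ (tensorPow τ k) m ρ ∈ A (m * k)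

/-- Axiom Q.II: closedness under tensor powers. -/
def AxiomQII {ι : Type*} (A : ∀ n : ℕ, Set (MatN ι n)) : Prop :=
  ∀ m k : ℕ, 1 ≤ m → 1 ≤ k → ∀ ρ ∈ A k, powBlocks ρ m ∈ A (m * k)

/-- Axiom Q.III: closedness under permutations of the tensor factors. -/
def AxiomQIII {ι : Type*} (A : ∀ n : ℕ, Set (MatN ι n)) : Prop :=
  ∀ n : ℕ, ∀ ρ ∈ A n, ∀ π : Equiv.Perm (Fin n), permCopies π ρ ∈ A n

/-- Axiom Q.IV: filtering by Hermitian operators in a neighbourhood of the identity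
is completely `cone(𝒜)`-preserving. -/
def AxiomQIV {ι : Type*} [Fintype ι] [DecidableEq ι] (A : ∀ n : ℕ, Set (MatN ι n)) : Prop :=
  ∀ k : ℕ, 1 ≤ k →
    ∃ V : Set (MatN ι k), V ∈ nhds (1 : MatN ι k) ∧
      ∀ F ∈ V, F.IsHermitian → ∀ n : ℕ, 1 ≤ n → ∀ ρ ∈ A (n + k),
        ∃ (lam : ℝ) (ω : MatN ι n), 0 ≤ lam ∧ ω ∈ A n ∧ condReduce ρ F = (lam : ℂ) • ω

section Spectral

set_option linter.unusedSectionVars false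

variable {κ : Type*} [Fintype κ] [DecidableEq κ]

/-- The diagonal entries of `U† ρ U`, i.e. the outcome weights of `ρ` in the basis given by the
columns of `U`. -/
def basisWeight (U ρ : Matrix κ κ ℂ) (j : κ) : ℝ := ((star U * ρ * U) j j).re

lemma trace_mul_conj_diagonal (U ρ : Matrix κ κ ℂ) (f : κ → ℝ) :
    (ρ * (U * Matrix.diagonal (fun i => (f i : ℂ)) * star U)).trace.re =
      ∑ j, f j * basisWeight U ρ j := by
  have h : (ρ * (U * Matrix.diagonal (fun i => (f i : ℂ)) * star U)).trace =
      (star U * ρ * U * Matrix.diagonal (fun i => (f i : ℂ))).trace := by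
    rw [← Matrix.mul_assoc, Matrix.trace_mul_comm]
    simp only [Matrix.mul_assoc]
  rw [h, Matrix.trace, Complex.re_sum]
  refine Finset.sum_congr rfl fun j _ => ?_
  rw [Matrix.diag_apply, Matrix.mul_diagonal, Complex.re_mul_ofReal, basisWeight, mul_comm]

lemma basisWeight_nonneg {ρ : Matrix κ κ ℂ} (hρ : ρ.PosSemidef) (U : Matrix κ κ ℂ) (j : κ) :
    0 ≤ basisWeight U ρ j := by
  have h := (hρ.conjTranspose_mul_mul_same U).diag_nonneg (i := j)
  exact (Complex.le_def.1 h).1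

lemma sum_basisWeight {U : Matrix κ κ ℂ} (hU : U * star U = 1) (ρ : Matrix κ κ ℂ) :
    ∑ j, basisWeight U ρ j = ρ.trace.re := by
  have h := trace_mul_conj_diagonal U ρ (fun _ => 1)
  simp only [Complex.ofReal_one, one_mul] at h
  rw [← h, Matrix.diagonal_one, Matrix.mul_one, hU, Matrix.mul_one]

lemma eigenvectorUnitary_mul_star {A : Matrix κ κ ℂ} (hA : A.IsHermitian) :
    (hA.eigenvectorUnitary : Matrix κ κ ℂ) * star (hA.eigenvectorUnitary : Matrix κ κ ℂ) = 1 :=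
  Unitary.coe_mul_star_self _

lemma star_mul_eigenvectorUnitary {A : Matrix κ κ ℂ} (hA : A.IsHermitian) :
    star (hA.eigenvectorUnitary : Matrix κ κ ℂ) * (hA.eigenvectorUnitary : Matrix κ κ ℂ) = 1 :=
  Unitary.coe_star_mul_self _

lemma eq_conj_diagonal {A : Matrix κ κ ℂ} (hA : A.IsHermitian) :
    A = (hA.eigenvectorUnitary : Matrix κ κ ℂ) *
      Matrix.diagonal (fun i => (hA.eigenvalues i : ℂ)) *
      star (hA.eigenvectorUnitary : Matrix κ κ ℂ) := by
  conv_lhs => rw [hA.spectral_theorem, Unitary.conjStarAlgAut_apply]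
  rfl

lemma cfc_eq_conj_diagonal {A : Matrix κ κ ℂ} (hA : A.IsHermitian) (f : ℝ → ℝ) :
    cfc f A = (hA.eigenvectorUnitary : Matrix κ κ ℂ) *
      Matrix.diagonal (fun i => (f (hA.eigenvalues i) : ℂ)) *
      star (hA.eigenvectorUnitary : Matrix κ κ ℂ) := by
  rw [hA.cfc_eq, Matrix.IsHermitian.cfc, Unitary.conjStarAlgAut_apply]
  rfl

lemma matLog_eq_cfc {A : Matrix κ κ ℂ} (hA : A.IsHermitian) : matLog A = cfc Real.log A := by
  rw [cfc_eq_conj_diagonal hA, matLog, dif_pos hA]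

lemma trace_mul_cfc {A : Matrix κ κ ℂ} (hA : A.IsHermitian) (f : ℝ → ℝ) (ρ : Matrix κ κ ℂ) :
    (ρ * cfc f A).trace.re =
      ∑ j, f (hA.eigenvalues j) * basisWeight (hA.eigenvectorUnitary : Matrix κ κ ℂ) ρ j := by
  rw [cfc_eq_conj_diagonal hA, trace_mul_conj_diagonal]

lemma continuousOn_spectrum (A : Matrix κ κ ℂ) (f : ℝ → ℝ) : ContinuousOn f (spectrum ℝ A) :=
  (Matrix.finite_real_spectrum (A := A)).continuousOn f

lemma isHermitian_add_smul_one {A : Matrix κ κ ℂ} (hA : A.IsHermitian) (η : ℝ) :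
    (A + (η : ℂ) • (1 : Matrix κ κ ℂ)).IsHermitian := by
  refine hA.add ?_
  rw [Matrix.IsHermitian, Matrix.conjTranspose_smul, Matrix.conjTranspose_one]
  simp

lemma posDef_add_smul_one {A : Matrix κ κ ℂ} (hA : A.PosSemidef) {η : ℝ} (hη : 0 < η) :
    (A + (η : ℂ) • (1 : Matrix κ κ ℂ)).PosDef :=
  Matrix.PosDef.posSemidef_add hA (Matrix.PosDef.one.smul (by exact_mod_cast hη))

lemma matLog_add_smul_one {A : Matrix κ κ ℂ} (hA : A.IsHermitian) (η : ℝ) :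
    matLog (A + (η : ℂ) • (1 : Matrix κ κ ℂ)) = cfc (fun x => Real.log (x + η)) A := by
  have hA' : IsSelfAdjoint A := hA
  have h : cfc (fun x : ℝ => x + η) A = A + (η : ℂ) • (1 : Matrix κ κ ℂ) := by
    rw [cfc_add_const η (fun x => x) A (continuousOn_spectrum A _) hA', cfc_id' ℝ A hA']
    congr 1
    ext i j
    simp [Matrix.algebraMap_matrix_apply, Matrix.one_apply, Matrix.smul_apply]
  rw [matLog_eq_cfc (isHermitian_add_smul_one hA η), ← h]
  rw [← cfc_comp' Real.log (fun x => x + η) A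
    (((Matrix.finite_real_spectrum (A := A)).image _).continuousOn _) (continuousOn_spectrum A _)]

/-- Relative entropy with the second argument shifted by a multiple of the identity. -/
def shiftedRelEnt (η : ℝ) (ρ σ : Matrix κ κ ℂ) : ℝ :=
  (ρ * (matLog ρ - matLog (σ + (η : ℂ) • (1 : Matrix κ κ ℂ)))).trace.re

lemma trace_re_mul_sub (ρ A B : Matrix κ κ ℂ) :
    (ρ * (A - B)).trace.re = (ρ * A).trace.re - (ρ * B).trace.re := by
  rw [Matrix.mul_sub, Matrix.trace_sub, Complex.sub_re]

lemma shiftedRelEnt_eq {σ : Matrix κ κ ℂ} (hσ : σ.IsHermitian) (η : ℝ) (ρ : Matrix κ κ ℂ) :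
    shiftedRelEnt η ρ σ = (ρ * matLog ρ).trace.re -
      ∑ j, Real.log (hσ.eigenvalues j + η) *
        basisWeight (hσ.eigenvectorUnitary : Matrix κ κ ℂ) ρ j := by
  rw [shiftedRelEnt, trace_re_mul_sub, matLog_add_smul_one hσ, trace_mul_cfc hσ]

lemma suppLE_iff_exists_mul {ρ σ : Matrix κ κ ℂ} : suppLE ρ σ ↔ ∃ Z, ρ = σ * Z := by
  constructor
  · intro h
    have h1 : ∀ j, ∃ z, σ.mulVec z = ρ.mulVec (Pi.single j 1) := fun j => by
      have := h ⟨Pi.single j 1, rfl⟩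
      obtain ⟨z, hz⟩ := this
      exact ⟨z, by simpa [Matrix.toLin'_apply] using hz⟩
    choose z hz using h1
    refine ⟨Matrix.of fun i j => z j i, ?_⟩
    ext i j
    have := congrFun (hz j) i
    rw [Matrix.mulVec_single_one] at this
    rw [Matrix.mul_apply]
    exact this.symm
  · rintro ⟨Z, rfl⟩
    rw [suppLE, Matrix.toLin'_mul]
    exact LinearMap.range_comp_le_range _ _

lemma suppLE_iff_basisWeight {ρ σ : Matrix κ κ ℂ} (hρ : ρ.PosSemidef) (hσ : σ.IsHermitian) :
    suppLE ρ σ ↔ ∀ j, hσ.eigenvalues j = 0 →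
      basisWeight (hσ.eigenvectorUnitary : Matrix κ κ ℂ) ρ j = 0 := by
  rw [suppLE_iff_exists_mul]
  set U := (hσ.eigenvectorUnitary : Matrix κ κ ℂ) with hU
  constructor
  · rintro ⟨Z, hZ⟩ j hj
    have h1 : star U * σ = Matrix.diagonal (fun i => (hσ.eigenvalues i : ℂ)) * star U := by
      conv_lhs => rw [eq_conj_diagonal hσ]
      rw [← Matrix.mul_assoc, ← Matrix.mul_assoc, star_mul_eigenvectorUnitary, Matrix.one_mul]
    rw [basisWeight, hZ, ← Matrix.mul_assoc, h1, Matrix.mul_assoc, Matrix.mul_assoc,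
      Matrix.diagonal_mul, hj]
    simp
  · intro h
    set R := star U * ρ * U with hR
    have hRpos : R.PosSemidef := hρ.conjTranspose_mul_mul_same U
    have hρR : ρ = U * R * star U := by
      rw [hR]
      have e : U * (star U * ρ * U) * star U = (U * star U) * ρ * (U * star U) := by
        simp only [Matrix.mul_assoc]
      rw [e, eigenvectorUnitary_mul_star, Matrix.one_mul, Matrix.mul_one]
    have hrow : ∀ j, hσ.eigenvalues j = 0 → ∀ k, R j k = 0 := by
      intro j hj k
      have hz : R j j = 0 := by
        have h0 := hRpos.diag_nonneg (i := j)
        have := h j hj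
        rw [basisWeight] at this
        apply Complex.ext
        · simpa using this
        · exact (Complex.le_def.1 h0).2.symm
      have hv : R.mulVec (Pi.single j 1) = 0 := by
        rw [← hRpos.dotProduct_mulVec_zero_iff]
        simp [dotProduct, Pi.single_apply, hz, Matrix.col_apply]
      have h2 := congrFun hv k
      rw [Matrix.mulVec_single_one] at h2
      have h3 : R k j = 0 := h2
      rw [← hRpos.1.apply j k, h3, star_zero]
    refine ⟨U * Matrix.diagonal (fun i => ((hσ.eigenvalues i)⁻¹ : ℂ)) * R * star U, ?_⟩
    have e : U * Matrix.diagonal (fun i => (hσ.eigenvalues i : ℂ)) * star U *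
        (U * Matrix.diagonal (fun i => ((hσ.eigenvalues i)⁻¹ : ℂ)) * R * star U) =
        U * (Matrix.diagonal (fun i => (hσ.eigenvalues i : ℂ)) * (star U * U) *
        Matrix.diagonal (fun i => ((hσ.eigenvalues i)⁻¹ : ℂ)) * R) * star U := by
      simp only [Matrix.mul_assoc]
    refine Eq.trans ?_ (congrArg (· * (U * Matrix.diagonal (fun i => ((hσ.eigenvalues i)⁻¹ : ℂ)) *
      R * star U)) (eq_conj_diagonal hσ).symm)
    refine Eq.trans ?_ e.symm
    rw [star_mul_eigenvectorUnitary, Matrix.mul_one, Matrix.diagonal_mul_diagonal]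
    refine hρR.trans ?_
    congr 2
    ext i k
    rw [Matrix.diagonal_mul]
    by_cases hi : hσ.eigenvalues i = 0
    · rw [hrow i hi k, mul_zero]
    · rw [mul_inv_cancel₀ (by exact_mod_cast hi), one_mul]

lemma shiftedRelEnt_le_relEnt {ρ σ : Matrix κ κ ℂ} (hρ : ρ.PosSemidef) (hσ : σ.PosSemidef)
    {η : ℝ} (hη : 0 < η) : (shiftedRelEnt η ρ σ : EReal) ≤ relEnt ρ σ := by
  rw [relEnt]
  split_ifs with h
  · rw [EReal.coe_le_coe_iff, shiftedRelEnt_eq hσ.1, trace_re_mul_sub, matLog_eq_cfc hσ.1,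
      trace_mul_cfc hσ.1]
    refine sub_le_sub_left (Finset.sum_le_sum fun j _ => ?_) _
    have hw := basisWeight_nonneg hρ (hσ.1.eigenvectorUnitary : Matrix κ κ ℂ) j
    rcases (hσ.eigenvalues_nonneg j).eq_or_lt with h0 | h0
    · rw [(suppLE_iff_basisWeight hρ hσ.1).1 h j h0.symm, mul_zero, mul_zero]
    · exact mul_le_mul_of_nonneg_right (Real.log_le_log h0 (by linarith)) hw
  · exact le_top

lemma exists_lt_shiftedRelEnt {ρ σ : Matrix κ κ ℂ} (hρ : ρ.PosSemidef) (hσ : σ.PosSemidef)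
    {c : ℝ} (hc : (c : EReal) < relEnt ρ σ) :
    ∀ᶠ η in 𝓝[>] (0 : ℝ), c < shiftedRelEnt η ρ σ := by
  simp only [shiftedRelEnt_eq hσ.1]
  set w := basisWeight (hσ.1.eigenvectorUnitary : Matrix κ κ ℂ) ρ with hw
  have hw0 : ∀ j, 0 ≤ w j := basisWeight_nonneg hρ _
  by_cases h : suppLE ρ σ
  · rw [relEnt, if_pos h, EReal.coe_lt_coe_iff, trace_re_mul_sub, matLog_eq_cfc hσ.1,
      trace_mul_cfc hσ.1] at hc
    refine Tendsto.eventually_const_lt hc ?_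
    refine Tendsto.const_sub _ (tendsto_finsetSum _ fun j _ => ?_)
    by_cases h0 : hσ.1.eigenvalues j = 0
    · have hwj : w j = 0 := (suppLE_iff_basisWeight hρ hσ.1).1 h j h0
      simp [hwj, ← hw]
    · refine Tendsto.mul_const _ ((Real.continuousAt_log h0).tendsto.comp ?_)
      have : Tendsto (fun x : ℝ => hσ.1.eigenvalues j + x) (𝓝 0) (𝓝 (hσ.1.eigenvalues j + 0)) :=
        tendsto_const_nhds.add tendsto_id
      rw [add_zero] at this
      exact this.mono_left nhdsWithin_le_nhds
  · have h' := h
    rw [suppLE_iff_basisWeight hρ hσ.1] at h'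
    push Not at h'
    obtain ⟨j₀, hj₀, hwj₀⟩ := h'
    have hpos : 0 < w j₀ := lt_of_le_of_ne (hw0 j₀) (Ne.symm hwj₀)
    set C : ℝ := ∑ j ∈ Finset.univ.erase j₀, Real.log (hσ.1.eigenvalues j + 1) * w j with hC
    have hlim : Tendsto (fun η : ℝ => (ρ * matLog ρ).trace.re - C - Real.log η * w j₀)
        (𝓝[>] 0) atTop := by
      refine tendsto_atTop_add_const_left _ _ ?_
      refine tendsto_neg_atBot_atTop.comp ?_
      exact Tendsto.atBot_mul_const hpos Real.tendsto_log_nhdsGT_zero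
    filter_upwards [hlim.eventually_gt_atTop c, Ioo_mem_nhdsGT (zero_lt_one)] with η h1 h2
    refine h1.trans_le ?_
    rw [← Finset.add_sum_erase _ _ (Finset.mem_univ j₀), hj₀, zero_add, sub_sub, add_comm C]
    refine sub_le_sub_left (add_le_add le_rfl (Finset.sum_le_sum fun j _ => ?_)) _
    have := hσ.eigenvalues_nonneg j
    exact mul_le_mul_of_nonneg_right (Real.log_le_log (by linarith [h2.1]) (by linarith [h2.2]))
      (hw0 j)

end Spectral

section Converse

set_option linter.unusedSectionVars false

variable {κ : Type*} [Fintype κ] [DecidableEq κ]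

lemma trace_mul_nonneg {A B : Matrix κ κ ℂ} (hA : A.PosSemidef) (hB : B.PosSemidef) :
    0 ≤ (A * B).trace.re := by
  have hB' : IsSelfAdjoint B := hB.1
  have h := trace_mul_cfc hB.1 (fun x => x) A
  rw [cfc_id' ℝ B hB'] at h
  rw [h]
  exact Finset.sum_nonneg fun j _ =>
    mul_nonneg (hB.eigenvalues_nonneg j) (basisWeight_nonneg hA _ j)

lemma posSemidef_sub_sq {F : Matrix κ κ ℂ} (hF : F.PosSemidef) (hF1 : (1 - F).PosSemidef) :
    (F - F * F).PosSemidef := by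
  have e : F - F * F =
      F.conjTranspose * (1 - F) * F + (1 - F).conjTranspose * F * (1 - F) := by
    rw [hF.1, hF1.1]
    noncomm_ring
  rw [e]
  exact (hF1.conjTranspose_mul_mul_same F).add (hF.conjTranspose_mul_mul_same (1 - F))

lemma basisWeight_conj_diagonal (X Y : Matrix κ κ ℂ) (l : κ → ℝ) (j : κ) :
    basisWeight Y (X * Matrix.diagonal (fun i => (l i : ℂ)) * star X) j =
      ∑ i, l i * Complex.normSq ((star X * Y) i j) := by
  have e : star Y * (X * Matrix.diagonal (fun i => (l i : ℂ)) * star X) * Y =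
      star (star X * Y) * (Matrix.diagonal (fun i => (l i : ℂ)) * (star X * Y)) := by
    rw [star_mul, star_star]
    simp only [Matrix.mul_assoc]
  rw [basisWeight, e, Matrix.mul_apply, Complex.re_sum]
  refine Finset.sum_congr rfl fun i _ => ?_
  rw [Matrix.diagonal_mul, Matrix.star_apply, mul_left_comm, Complex.re_ofReal_mul]
  congr 1
  rw [Complex.star_def, mul_comm, Complex.mul_conj, Complex.ofReal_re]

lemma sum_normSq_le_trace {X Y : Matrix κ κ ℂ} (hY : Y * star Y = 1) {l : κ → ℝ}
    {F : Matrix κ κ ℂ} (hF : F.PosSemidef) (hF1 : (1 - F).PosSemidef)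
    (hP : (X * Matrix.diagonal (fun i => (l i : ℂ)) * star X).PosSemidef) :
    ∑ i, ∑ j, l i * Complex.normSq ((star X * F * Y) i j) ≤
      (X * Matrix.diagonal (fun i => (l i : ℂ)) * star X * F).trace.re := by
  set P := X * Matrix.diagonal (fun i => (l i : ℂ)) * star X with hPdef
  have h1 : ∑ j, basisWeight (F * Y) P j = (P * (F * F)).trace.re := by
    have e : ∀ j, basisWeight (F * Y) P j = basisWeight Y (F * P * F) j := fun j => by
      have hFs : star F = F := hF.1
      simp only [basisWeight, star_mul, hFs, Matrix.mul_assoc]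
    rw [Finset.sum_congr rfl fun j _ => e j, sum_basisWeight hY, Matrix.mul_assoc,
      Matrix.trace_mul_comm, Matrix.mul_assoc]
  have h2 : ∑ i, ∑ j, l i * Complex.normSq ((star X * F * Y) i j) =
      ∑ j, basisWeight (F * Y) P j := by
    rw [Finset.sum_comm]
    refine Finset.sum_congr rfl fun j _ => ?_
    rw [hPdef, basisWeight_conj_diagonal, Matrix.mul_assoc]
  rw [h2, h1, ← sub_nonneg, ← trace_re_mul_sub]
  exact trace_mul_nonneg hP (posSemidef_sub_sq hF hF1)

lemma sub_div_le_min {l m K : ℝ} (hl : 0 ≤ l) (hm : 0 < m) (hK : 0 < K) :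
    l - (l * Real.log l - Real.log m * l + m) / K ≤ min l (Real.exp K * m) := by
  have key : l - m ≤ l * Real.log l - Real.log m * l := by
    rcases hl.eq_or_lt with rfl | hl'
    · simp [hm.le]
    · have h := Real.log_le_sub_one_of_pos (div_pos hm hl')
      rw [Real.log_div hm.ne' hl'.ne'] at h
      have h2 := mul_le_mul_of_nonneg_left h hl
      have h3 : l * (m / l - 1) = m - l := by field_simp
      linarith
  rcases le_or_gt l (Real.exp K * m) with h | h
  · rw [min_eq_left h]
    have : 0 ≤ (l * Real.log l - Real.log m * l + m) / K := div_nonneg (by linarith) hK.le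
    linarith
  · rw [min_eq_right h.le]
    have h1 : Real.log (Real.exp K * m) ≤ Real.log l := Real.log_le_log (by positivity) h.le
    rw [Real.log_mul (Real.exp_pos K).ne' hm.ne', Real.log_exp] at h1
    have h2 := mul_le_mul_of_nonneg_left h1 hl
    have h3 : l ≤ (l * Real.log l - Real.log m * l + m) / K := by
      rw [le_div_iff₀ hK]
      linarith
    have : 0 < Real.exp K * m := by positivity
    linarith

lemma half_min_mul_normSq_le {l m : ℝ} (hl : 0 ≤ l) (hm : 0 ≤ m) (a b : ℂ) :
    min l m * Complex.normSq (a + b) ≤ 2 * (l * Complex.normSq a + m * Complex.normSq b) := by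
  have h1 : Complex.normSq (a + b) ≤ 2 * (Complex.normSq a + Complex.normSq b) := by
    simp only [Complex.normSq_apply, Complex.add_re, Complex.add_im]
    nlinarith [sq_nonneg (a.re - b.re), sq_nonneg (a.im - b.im)]
  have h0 : 0 ≤ min l m := le_min hl hm
  have h2 := mul_le_mul_of_nonneg_left h1 h0
  have h3 := mul_le_mul_of_nonneg_right (min_le_left l m) (Complex.normSq_nonneg a)
  have h4 := mul_le_mul_of_nonneg_right (min_le_right l m) (Complex.normSq_nonneg b)
  linarith

lemma shiftedRelEnt_test_bound {ρ σ E : Matrix κ κ ℂ} (hρ : ρ.PosSemidef) (hρ1 : ρ.trace = 1)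
    (hσ : σ.PosSemidef) (hE : E.PosSemidef) (hE1 : (1 - E).PosSemidef) {K η : ℝ}
    (hK : 0 < K) (hη : 0 < η) :
    1 - (shiftedRelEnt η ρ σ + (σ.trace.re + η * Fintype.card κ)) / K ≤
      2 * ((ρ * (1 - E)).trace.re + Real.exp K * ((σ * E).trace.re + η * E.trace.re)) := by
  set X := (hρ.1.eigenvectorUnitary : Matrix κ κ ℂ) with hX
  set Y := (hσ.1.eigenvectorUnitary : Matrix κ κ ℂ) with hY
  set l := hρ.1.eigenvalues with hl
  set m : κ → ℝ := fun j => hσ.1.eigenvalues j + η with hm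
  have hl0 : ∀ i, 0 ≤ l i := hρ.eigenvalues_nonneg
  have hm0 : ∀ j, 0 < m j := fun j => add_pos_of_nonneg_of_pos (hσ.eigenvalues_nonneg j) hη
  have hXX : X * star X = 1 := eigenvectorUnitary_mul_star hρ.1
  have hYY : Y * star Y = 1 := eigenvectorUnitary_mul_star hσ.1
  have hXX' : star X * X = 1 := star_mul_eigenvectorUnitary hρ.1
  have hYY' : star Y * Y = 1 := star_mul_eigenvectorUnitary hσ.1
  have hρe : ρ = X * Matrix.diagonal (fun i => (l i : ℂ)) * star X := eq_conj_diagonal hρ.1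
  set τ := σ + (η : ℂ) • (1 : Matrix κ κ ℂ) with hτ
  have hτe : τ = Y * Matrix.diagonal (fun i => (m i : ℂ)) * star Y := by
    have e1 : Matrix.diagonal (fun i => (m i : ℂ)) =
        Matrix.diagonal (fun i => (hσ.1.eigenvalues i : ℂ)) + (η : ℂ) • (1 : Matrix κ κ ℂ) := by
      ext i j
      by_cases hij : i = j
      · subst hij; simp [hm]
      · simp [hij]
    rw [e1, Matrix.mul_add, Matrix.add_mul, ← eq_conj_diagonal hσ.1, Matrix.mul_smul,
      Matrix.smul_mul, Matrix.mul_one, hYY]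
  have hτpos : τ.PosSemidef := (posDef_add_smul_one hσ hη).posSemidef
  set G := star X * Y with hG
  have hGG : G * star G = 1 := by
    rw [hG, star_mul, star_star, Matrix.mul_assoc, ← Matrix.mul_assoc Y, hYY, Matrix.one_mul, hXX']
  have hGG' : star G * G = 1 := by
    rw [hG, star_mul, star_star, Matrix.mul_assoc, ← Matrix.mul_assoc X, hXX, Matrix.one_mul, hYY']
  have hrow : ∀ i, ∑ j, Complex.normSq (G i j) = 1 := fun i => by
    have := congrFun (congrFun hGG i) i
    rw [Matrix.mul_apply, Matrix.one_apply_eq] at this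
    have h2 := congrArg Complex.re this
    rw [Complex.re_sum, Complex.one_re] at h2
    rw [← h2]
    refine Finset.sum_congr rfl fun j _ => ?_
    rw [Matrix.star_apply, Complex.star_def, Complex.mul_conj, Complex.ofReal_re]
  have hcol : ∀ j, ∑ i, Complex.normSq (G i j) = 1 := fun j => by
    have := congrFun (congrFun hGG' j) j
    rw [Matrix.mul_apply, Matrix.one_apply_eq] at this
    have h2 := congrArg Complex.re this
    rw [Complex.re_sum, Complex.one_re] at h2
    rw [← h2]
    refine Finset.sum_congr rfl fun i _ => ?_
    rw [Matrix.star_apply, Complex.star_def, mul_comm, Complex.mul_conj, Complex.ofReal_re]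
  have hwt : ∀ j, basisWeight Y ρ j = ∑ i, l i * Complex.normSq (G i j) := fun j => by
    conv_lhs => rw [hρe]
    rw [basisWeight_conj_diagonal]
  have hlsum : ∑ i, l i = 1 := by
    have h := hρ.1.trace_eq_sum_eigenvalues
    rw [hρ1] at h
    have h2 := congrArg Complex.re h
    simpa using h2.symm
  have hmsum : ∑ j, m j = σ.trace.re + η * Fintype.card κ := by
    have h := congrArg Complex.re hσ.1.trace_eq_sum_eigenvalues
    have h' : σ.trace.re = ∑ j, hσ.1.eigenvalues j := by simpa using h
    simp [hm, Finset.sum_add_distrib, h', mul_comm]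
  have hent : (ρ * matLog ρ).trace.re = ∑ i, l i * Real.log (l i) := by
    rw [matLog_eq_cfc hρ.1, trace_mul_cfc hρ.1]
    refine Finset.sum_congr rfl fun i _ => ?_
    have h : basisWeight X ρ i = l i := by
      conv_lhs => rw [hρe]
      rw [basisWeight_conj_diagonal, hXX', Finset.sum_eq_single i]
      · simp
      · intro b _ hb
        simp [Matrix.one_apply_ne hb]
      · simp
    rw [← hX, h, mul_comm]
  have hD : ∑ i, ∑ j, (l i - (l i * Real.log (l i) - Real.log (m j) * l i + m j) / K) *
      Complex.normSq (G i j) =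
      1 - (shiftedRelEnt η ρ σ + (σ.trace.re + η * Fintype.card κ)) / K := by
    have e : ∀ i j, (l i - (l i * Real.log (l i) - Real.log (m j) * l i + m j) / K) *
        Complex.normSq (G i j) = (l i - l i * Real.log (l i) / K) * Complex.normSq (G i j) +
        (Real.log (m j) * (l i * Complex.normSq (G i j)) / K - m j / K * Complex.normSq (G i j)) :=
      fun i j => by ring
    simp only [e, Finset.sum_add_distrib, Finset.sum_sub_distrib]
    rw [Finset.sum_comm (f := fun i j => Real.log (m j) * (l i * Complex.normSq (G i j)) / K),
      Finset.sum_comm (f := fun i j => m j / K * Complex.normSq (G i j))]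
    simp only [← Finset.mul_sum, ← Finset.sum_div, hrow, hcol, mul_one]
    rw [Finset.sum_sub_distrib, hlsum, ← Finset.sum_div, ← hent, hmsum, shiftedRelEnt_eq hσ.1]
    simp only [← hwt, ← hY, hm]
    ring
  have h1 := sum_normSq_le_trace (X := X) (Y := Y) hYY (l := l) hE1 (by simpa using hE)
    (hρe ▸ hρ)
  rw [← hρe] at h1
  have h2 := sum_normSq_le_trace (X := Y) (Y := X) hXX (l := m) hE hE1 (hτe ▸ hτpos)
  rw [← hτe] at h2
  have h3 : (τ * E).trace.re = (σ * E).trace.re + η * E.trace.re := by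
    rw [hτ, Matrix.add_mul, Matrix.trace_add, Matrix.smul_mul, Matrix.one_mul, Matrix.trace_smul,
      Complex.add_re, smul_eq_mul, Complex.re_ofReal_mul]
  rw [← hD, ← h3]
  have h4 : ∑ i, ∑ j, m i * Complex.normSq ((star Y * E * X) i j) =
      ∑ i, ∑ j, m j * Complex.normSq ((star X * E * Y) i j) := by
    rw [Finset.sum_comm]
    refine Finset.sum_congr rfl fun i _ => Finset.sum_congr rfl fun j _ => ?_
    have hEs : star E = E := hE.1
    have : star X * E * Y = star (star Y * E * X) := by
      simp only [star_mul, star_star, hEs, Matrix.mul_assoc]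
    rw [this, Matrix.star_apply, Complex.star_def, Complex.normSq_conj]
  rw [h4] at h2
  have h5 : ∑ i, ∑ j, (l i - (l i * Real.log (l i) - Real.log (m j) * l i + m j) / K) *
      Complex.normSq (G i j) ≤ ∑ i, ∑ j, 2 * (l i * Complex.normSq ((star X * (1 - E) * Y) i j) +
        Real.exp K * m j * Complex.normSq ((star X * E * Y) i j)) := by
    refine Finset.sum_le_sum fun i _ => Finset.sum_le_sum fun j _ => ?_
    have hsum : G i j = (star X * (1 - E) * Y) i j + (star X * E * Y) i j := by
      rw [← Matrix.add_apply, ← Matrix.add_mul, ← Matrix.mul_add, sub_add_cancel, Matrix.mul_one]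
    rw [hsum]
    refine le_trans (mul_le_mul_of_nonneg_right (sub_div_le_min (hl0 i) (hm0 j) hK)
      (Complex.normSq_nonneg _)) ?_
    exact half_min_mul_normSq_le (hl0 i) (mul_nonneg (Real.exp_pos K).le (hm0 j).le) _ _
  refine h5.trans ?_
  have h6 : ∑ i, ∑ j, 2 * (l i * Complex.normSq ((star X * (1 - E) * Y) i j) +
        Real.exp K * m j * Complex.normSq ((star X * E * Y) i j)) =
      2 * (∑ i, ∑ j, l i * Complex.normSq ((star X * (1 - E) * Y) i j) +
        Real.exp K * ∑ i, ∑ j, m j * Complex.normSq ((star X * E * Y) i j)) := by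
    simp only [Finset.mul_sum, Finset.sum_add_distrib, mul_add, mul_assoc]
  rw [h6]
  have h7 := mul_le_mul_of_nonneg_left h2 (Real.exp_pos K).le
  linarith

/-- A small relative entropy forces the error probabilities of every test to be large. -/
lemma relEnt_test_bound {ρ σ E : Matrix κ κ ℂ} (hρ : IsState ρ) (hσ : IsState σ)
    (hE : E.PosSemidef) (hE1 : (1 - E).PosSemidef) {K D : ℝ} (hK : 0 < K)
    (hD : relEnt ρ σ ≤ D) :
    1 - (D + 1) / K ≤ 2 * ((ρ * (1 - E)).trace.re + Real.exp K * (σ * E).trace.re) := by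
  have hlim1 : Tendsto (fun η : ℝ => 1 - (D + (1 + η * Fintype.card κ)) / K) (𝓝[>] 0)
      (𝓝 (1 - (D + (1 + 0 * Fintype.card κ)) / K)) :=
    Tendsto.mono_left (Continuous.tendsto (by fun_prop) 0) nhdsWithin_le_nhds
  have hlim2 : Tendsto (fun η : ℝ => 2 * ((ρ * (1 - E)).trace.re +
      Real.exp K * ((σ * E).trace.re + η * E.trace.re))) (𝓝[>] 0)
      (𝓝 (2 * ((ρ * (1 - E)).trace.re + Real.exp K * ((σ * E).trace.re + 0 * E.trace.re)))) :=
    Tendsto.mono_left (Continuous.tendsto (by fun_prop) 0) nhdsWithin_le_nhds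
  rw [zero_mul, add_zero] at hlim1 hlim2
  refine le_of_tendsto_of_tendsto hlim1 hlim2 ?_
  filter_upwards [self_mem_nhdsWithin] with η hη
  have h := shiftedRelEnt_test_bound hρ.1 hρ.2 hσ.1 hE hE1 hK hη
  rw [hσ.2, Complex.one_re] at h
  refine le_trans ?_ h
  have h2 : shiftedRelEnt η ρ σ ≤ D :=
    EReal.coe_le_coe_iff.1 ((shiftedRelEnt_le_relEnt hρ.1 hσ.1 hη).trans hD)
  gcongr

lemma neg_one_le_relEnt {ρ σ : Matrix κ κ ℂ} (hρ : IsState ρ) (hσ : IsState σ) {D : ℝ}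
    (hD : relEnt ρ σ ≤ D) : -1 ≤ D := by
  by_contra! h
  have h1 := relEnt_test_bound hρ hσ (E := 0) Matrix.PosSemidef.zero
    (by simpa using Matrix.PosSemidef.one) (K := -(D + 1) / 2) (by linarith) hD
  have h2 : (D + 1) / (-(D + 1) / 2) = -2 := by
    have : D + 1 ≠ 0 := by linarith
    field_simp
  rw [h2] at h1
  simp [hρ.2] at h1
  norm_num at h1

end Converse

section Symmetric

variable {ι : Type*} [Fintype ι] [DecidableEq ι]

/-- The algebra of operators on the `n`-fold tensor power invariant under permuting the copies. -/
def symSubalgebra (ι : Type*) [Fintype ι] [DecidableEq ι] (n : ℕ) :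
    Subalgebra ℂ (MatN ι n) where
  carrier := {M | ∀ (π : Equiv.Perm (Fin n)) (i j : Fin n → ι), M (i ∘ π) (j ∘ π) = M i j}
  mul_mem' := by
    intro M N hM hN π i j
    rw [Matrix.mul_apply, Matrix.mul_apply,
      ← Equiv.sum_comp (Equiv.arrowCongr π.symm (Equiv.refl ι))]
    refine Finset.sum_congr rfl fun k _ => ?_
    have e : (Equiv.arrowCongr π.symm (Equiv.refl ι)) k = k ∘ π := by
      ext t; simp [Equiv.arrowCongr]
    rw [e, hM, hN]
  add_mem' := by
    intro M N hM hN π i j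
    rw [Matrix.add_apply, Matrix.add_apply, hM, hN]
  algebraMap_mem' := by
    intro r π i j
    have h : i ∘ π = j ∘ π ↔ i = j := π.surjective.injective_comp_right.eq_iff
    simp only [Matrix.algebraMap_matrix_apply, h]

lemma tensorPow_mem_symSubalgebra (ρ : MatC ι) (n : ℕ) :
    tensorPow ρ n ∈ symSubalgebra ι n := fun π i j =>
  Equiv.prod_comp π fun k => ρ (i k) (j k)

/-- Two words with the same letter counts agree up to a permutation of the positions. -/
lemma exists_perm_of_card_fiber_eq {α β : Type*} [Fintype α] [DecidableEq β] {p q : α → β}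
    (h : ∀ b, Fintype.card {a // p a = b} = Fintype.card {a // q a = b}) :
    ∃ π : Equiv.Perm α, q ∘ π = p := by
  let e : ∀ b, {a // p a = b} ≃ {a // q a = b} := fun b => Fintype.equivOfCardEq (h b)
  exact ⟨Equiv.ofFiberEquiv e, funext fun a => Equiv.ofFiberEquiv_map e a⟩

/-- The joint letter counts of a pair of words. -/
def pairType {n : ℕ} (p : (Fin n → ι) × (Fin n → ι)) (b : ι × ι) : Fin (n + 1) :=
  ⟨Fintype.card {t // (p.1 t, p.2 t) = b}, Nat.lt_succ_of_le
    ((Fintype.card_subtype_le _).trans (by simp))⟩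

lemma apply_eq_of_pairType_eq {n : ℕ} {M : MatN ι n} (hM : M ∈ symSubalgebra ι n)
    {p q : (Fin n → ι) × (Fin n → ι)} (h : pairType p = pairType q) : M p.1 p.2 = M q.1 q.2 := by
  obtain ⟨π, hπ⟩ := exists_perm_of_card_fiber_eq (p := fun t => (p.1 t, p.2 t))
    (q := fun t => (q.1 t, q.2 t)) fun b => by
      have := congrArg Fin.val (congrFun h b)
      simpa [pairType] using this
  have h1 : q.1 ∘ π = p.1 := funext fun t => congrArg Prod.fst (congrFun hπ t)
  have h2 : q.2 ∘ π = p.2 := funext fun t => congrArg Prod.snd (congrFun hπ t)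
  rw [← h1, ← h2, hM]

lemma finrank_symSubalgebra_le (n : ℕ) :
    Module.finrank ℂ (symSubalgebra ι n) ≤ (n + 1) ^ (Fintype.card ι * Fintype.card ι) := by
  let T := Set.range (pairType (ι := ι) (n := n))
  let L : symSubalgebra ι n →ₗ[ℂ] (T → ℂ) :=
    { toFun := fun M t => (M : MatN ι n) t.2.choose.1 t.2.choose.2
      map_add' := fun _ _ => rfl
      map_smul' := fun _ _ => rfl }
  have hL : Function.Injective L := by
    intro M N h
    apply Subtype.ext
    ext i j
    let t : T := ⟨pairType (i, j), ⟨(i, j), rfl⟩⟩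
    have e := congrFun h t
    have hM := apply_eq_of_pairType_eq M.2 t.2.choose_spec
    have hN := apply_eq_of_pairType_eq N.2 t.2.choose_spec
    exact hM.symm.trans (e.trans hN)
  refine (LinearMap.finrank_le_finrank_of_injective hL).trans ?_
  rw [Module.finrank_fintype_fun_eq_card]
  refine (Fintype.card_subtype_le _).trans ?_
  simp

lemma card_image_eigenvalues_le {n : ℕ} {σ : MatN ι n} (hσ : σ ∈ symSubalgebra ι n)
    (h : σ.IsHermitian) :
    (Finset.univ.image h.eigenvalues).card ≤
      (n + 1) ^ (Fintype.card ι * Fintype.card ι) := by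
  refine le_trans ?_ (finrank_symSubalgebra_le (ι := ι) n)
  let x : symSubalgebra ι n := ⟨σ, hσ⟩
  refine le_trans ?_ (minpoly.natDegree_le (A := ℂ) x)
  have h0 : Polynomial.aeval σ (minpoly ℂ x) = 0 := by
    have := congrArg (symSubalgebra ι n).val (minpoly.aeval ℂ x)
    rwa [map_zero, ← Polynomial.aeval_algHom_apply] at this
  have hne : minpoly ℂ x ≠ 0 := minpoly.ne_zero (Algebra.IsIntegral.isIntegral x)
  rcases isEmpty_or_nonempty (Fin n → ι) with he | he
  · simp
  rw [← Finset.card_image_of_injective _ Complex.ofReal_injective]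
  refine le_trans (Finset.card_le_card (t := (minpoly ℂ x).roots.toFinset) ?_)
    ((Multiset.toFinset_card_le _).trans (Polynomial.card_roots' _))
  intro z hz
  obtain ⟨y, hy, rfl⟩ := Finset.mem_image.1 hz
  obtain ⟨i, -, rfl⟩ := Finset.mem_image.1 hy
  rw [Multiset.mem_toFinset, Polynomial.mem_roots hne, Polynomial.IsRoot.def]
  have hs : ((h.eigenvalues i : ℝ) : ℂ) ∈ spectrum ℂ σ := by
    rw [h.spectrum_eq_image_range]
    exact ⟨_, ⟨i, rfl⟩, rfl⟩
  have := spectrum.subset_polynomial_aeval σ (minpoly ℂ x) ⟨_, hs, rfl⟩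
  rw [h0, spectrum.zero_eq] at this
  exact this

lemma convexHull_subset_symSubalgebra {n : ℕ} {C : Set (MatC ι)} :
    convexHull ℝ (iidSet C n) ⊆ (symSubalgebra ι n : Set (MatN ι n)) := by
  refine convexHull_min ?_
    ((Subalgebra.toSubmodule (symSubalgebra ι n)).restrictScalars ℝ).convex
  rintro _ ⟨σ, -, rfl⟩
  exact tensorPow_mem_symSubalgebra σ n

/-- Carathéodory decomposition of a mixture of i.i.d. states into polynomially many terms. -/
lemma exists_decomp_of_mem_convexHull {n : ℕ} {C : Set (MatC ι)} {ρ : MatN ι n}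
    (h : ρ ∈ convexHull ℝ (iidSet C n)) :
    ∃ (K : ℕ) (z : Fin K → MatC ι) (p : Fin K → ℝ), (∀ k, z k ∈ C) ∧ (∀ k, 0 < p k) ∧
      ∑ k, p k = 1 ∧ ∑ k, p k • tensorPow (z k) n = ρ ∧
      K ≤ 2 * (n + 1) ^ (Fintype.card ι * Fintype.card ι) + 1 := by
  obtain ⟨J, hJ, z, p, hz, hind, hp, hp1, hρ⟩ := eq_pos_convex_span_of_mem_convexHull h
  have hz' : ∀ k, ∃ σ ∈ C, z k = tensorPow σ n := fun k => hz ⟨k, rfl⟩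
  choose y hy hzy using hz'
  let e := Fintype.equivFin J
  refine ⟨Fintype.card J, y ∘ e.symm, p ∘ e.symm, fun k => hy _, fun k => hp _, ?_, ?_, ?_⟩
  · rw [← hp1]; exact Equiv.sum_comp e.symm p
  · rw [← hρ]
    simp only [Function.comp, ← hzy]
    exact Equiv.sum_comp e.symm fun k => p k • z k
  · refine hind.card_le_finrank_succ.trans ?_
    have hsub : vectorSpan ℝ (Set.range z) ≤
        (Subalgebra.toSubmodule (symSubalgebra ι n)).restrictScalars ℝ := by
      rw [vectorSpan_def, Submodule.span_le]
      rintro _ ⟨a, ⟨k, rfl⟩, b, ⟨l, rfl⟩, rfl⟩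
      refine Submodule.sub_mem _ ?_ ?_
      · rw [hzy]; exact tensorPow_mem_symSubalgebra _ n
      · rw [hzy]; exact tensorPow_mem_symSubalgebra _ n
    have h1 := Submodule.finrank_mono hsub
    have h2 : Module.finrank ℝ
        ((Subalgebra.toSubmodule (symSubalgebra ι n)).restrictScalars ℝ) =
        2 * Module.finrank ℂ (symSubalgebra ι n) :=
      finrank_real_of_complex (symSubalgebra ι n)
    have h3 := finrank_symSubalgebra_le (ι := ι) n
    lia

end Symmetric

section Pinching

variable {κ : Type*} [Fintype κ] [DecidableEq κ]

/-- The spectral projection of a Hermitian matrix at the value `s`. -/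
def specProj (σ : Matrix κ κ ℂ) (s : ℝ) : Matrix κ κ ℂ :=
  cfc (fun x => if x = s then (1 : ℝ) else 0) σ

/-- The pinching of `ρ` by the spectral projections of `σ`. -/
def pinch {σ : Matrix κ κ ℂ} (hσ : σ.IsHermitian) (ρ : Matrix κ κ ℂ) : Matrix κ κ ℂ :=
  ∑ s ∈ Finset.univ.image hσ.eigenvalues, specProj σ s * ρ * specProj σ s

variable {σ : Matrix κ κ ℂ}

lemma specProj_isHermitian (σ : Matrix κ κ ℂ) (s : ℝ) : (specProj σ s).IsHermitian :=
  cfc_predicate (p := IsSelfAdjoint) _ σ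

lemma specProj_mul_self (σ : Matrix κ κ ℂ) (s : ℝ) :
    specProj σ s * specProj σ s = specProj σ s := by
  rw [specProj, ← cfc_mul _ _ σ (continuousOn_spectrum σ _) (continuousOn_spectrum σ _)]
  congr 1
  ext x
  split_ifs <;> simp

lemma sum_specProj (hσ : σ.IsHermitian) :
    ∑ s ∈ Finset.univ.image hσ.eigenvalues, specProj σ s = 1 := by
  simp only [specProj]
  rw [← cfc_sum _ σ _ fun _ _ => continuousOn_spectrum σ _]
  rw [cfc_eq_conj_diagonal hσ]
  have e : Matrix.diagonal (fun i => (((∑ s ∈ Finset.univ.image hσ.eigenvalues,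
      fun x : ℝ => if x = s then (1 : ℝ) else 0) (hσ.eigenvalues i) : ℝ) : ℂ)) =
      (1 : Matrix κ κ ℂ) := by
    rw [← Matrix.diagonal_one]
    congr 1
    ext i
    rw [Finset.sum_apply, Finset.sum_ite_eq, if_pos (Finset.mem_image_of_mem _ (Finset.mem_univ i))]
    simp
  rw [e, Matrix.mul_one, eigenvectorUnitary_mul_star]

lemma specProj_commute (hσ : σ.IsHermitian) (s : ℝ) : Commute (specProj σ s) σ := by
  have h : IsSelfAdjoint σ := hσ
  have := cfc_commute_cfc (fun x => if x = s then (1 : ℝ) else 0) (fun x => x) σ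
  rwa [cfc_id' ℝ σ h] at this

lemma pinch_posSemidef (hσ : σ.IsHermitian) {ρ : Matrix κ κ ℂ} (hρ : ρ.PosSemidef) :
    (pinch hσ ρ).PosSemidef := by
  refine Matrix.posSemidef_sum _ fun s _ => ?_
  have := hρ.conjTranspose_mul_mul_same (specProj σ s)
  rwa [(specProj_isHermitian σ s).eq] at this

lemma specProj_mul_eq_smul (hσ : σ.IsHermitian) (s : ℝ) : specProj σ s * σ = s • specProj σ s := by
  have h : IsSelfAdjoint σ := hσ
  have e := cfc_mul (fun x => if x = s then (1 : ℝ) else 0) (fun x => x) σ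
    (continuousOn_spectrum σ _) (continuousOn_spectrum σ _)
  rw [cfc_id' ℝ σ h] at e
  rw [specProj, ← e, ← cfc_smul s _ σ (continuousOn_spectrum σ _)]
  congr 1
  ext x
  split_ifs with hx <;> simp [hx]

lemma pinch_commute (hσ : σ.IsHermitian) (ρ : Matrix κ κ ℂ) : Commute (pinch hσ ρ) σ := by
  refine Commute.sum_left _ _ _ fun s _ => ?_
  have h1 := specProj_mul_eq_smul hσ s
  have h2 : σ * specProj σ s = s • specProj σ s := by
    rw [← h1]; exact (specProj_commute hσ s).symm
  rw [Commute, SemiconjBy, Matrix.mul_assoc, h1, ← Matrix.mul_assoc, ← Matrix.mul_assoc, h2]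
  simp

lemma trace_pinch (hσ : σ.IsHermitian) (ρ : Matrix κ κ ℂ) : (pinch hσ ρ).trace = ρ.trace := by
  rw [pinch, Matrix.trace_sum]
  have e : ∀ s, (specProj σ s * ρ * specProj σ s).trace = (specProj σ s * ρ).trace := fun s => by
    rw [Matrix.trace_mul_comm, ← Matrix.mul_assoc, specProj_mul_self]
  rw [Finset.sum_congr rfl fun s _ => e s, ← Matrix.trace_sum, ← Finset.sum_mul, sum_specProj,
    Matrix.one_mul]

/-- The pinching inequality. -/
lemma pinching_inequality (hσ : σ.IsHermitian) {ρ : Matrix κ κ ℂ} (hρ : ρ.PosSemidef) :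
    (((Finset.univ.image hσ.eigenvalues).card : ℝ) • pinch hσ ρ - ρ).PosSemidef := by
  set I := Finset.univ.image hσ.eigenvalues with hI
  set P := specProj σ with hP
  have e : ((I.card : ℝ) • pinch hσ ρ - ρ) = (2⁻¹ : ℝ) • ∑ s ∈ I, ∑ t ∈ I,
      (P s - P t) * ρ * (P s - P t) := by
    have h1 : ∀ s t, (P s - P t) * ρ * (P s - P t) =
        P s * ρ * P s + P t * ρ * P t - P s * ρ * P t - P t * ρ * P s := fun s t => by
      noncomm_ring
    have h2 : ∑ s ∈ I, ∑ t ∈ I, P s * ρ * P t = ρ := by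
      simp only [← Finset.mul_sum, ← Finset.sum_mul]
      rw [hI, sum_specProj hσ, Matrix.one_mul, Matrix.mul_one]
    have h3 : ∑ s ∈ I, ∑ t ∈ I, P t * ρ * P s = ρ := by rw [Finset.sum_comm]; exact h2
    simp only [h1, Finset.sum_sub_distrib, Finset.sum_add_distrib, h2, h3]
    simp only [Finset.sum_const, ← Finset.smul_sum]
    have h4 : ∑ s ∈ I, P s * ρ * P s = pinch hσ ρ := rfl
    rw [h4, ← Nat.cast_smul_eq_nsmul ℝ]
    module
  rw [e]
  refine Matrix.PosSemidef.smul ?_ (by positivity)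
  refine Matrix.posSemidef_sum _ fun s _ => Matrix.posSemidef_sum _ fun t _ => ?_
  have := hρ.conjTranspose_mul_mul_same (P s - P t)
  rwa [Matrix.conjTranspose_sub, (specProj_isHermitian σ s).eq,
    (specProj_isHermitian σ t).eq] at this

end Pinching

section LogMonotone

open scoped MatrixOrder Matrix.Norms.L2Operator

variable {κ : Type*} [Fintype κ] [DecidableEq κ]

lemma matLog_eq_log {A : Matrix κ κ ℂ} (hA : A.IsHermitian) : matLog A = CFC.log A :=
  matLog_eq_cfc hA

lemma trace_mul_matLog_mono {ρ A B : Matrix κ κ ℂ} (hρ : ρ.PosSemidef) (hA : A.PosDef)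
    (hAB : (B - A).PosSemidef) : (ρ * matLog A).trace.re ≤ (ρ * matLog B).trace.re := by
  have hB : B.PosDef := by
    have := hA.add_posSemidef hAB
    rwa [add_sub_cancel] at this
  have h : CFC.log A ≤ CFC.log B :=
    CFC.log_le_log (Matrix.le_iff.2 hAB) (ha := Matrix.isStrictlyPositive_iff_posDef.2 hA)
  rw [← matLog_eq_log hA.1, ← matLog_eq_log hB.1, Matrix.le_iff] at h
  have := trace_mul_nonneg hρ h
  rw [trace_re_mul_sub] at this
  linarith

lemma matLog_smul {A : Matrix κ κ ℂ} (hA : A.PosDef) {r : ℝ} (hr : 0 < r) :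
    matLog (r • A) = (Real.log r : ℂ) • (1 : Matrix κ κ ℂ) + matLog A := by
  have h1 : (r • A).PosDef := hA.smul hr
  rw [matLog_eq_log h1.1, matLog_eq_log hA.1,
    CFC.log_smul' A hr (Matrix.isStrictlyPositive_iff_posDef.2 hA)]
  congr 1
  rw [Algebra.algebraMap_eq_smul_one]
  ext i j
  simp

lemma trace_mul_matLog_smul {ρ A : Matrix κ κ ℂ} (hρ : ρ.trace = 1) (hA : A.PosDef) {r : ℝ}
    (hr : 0 < r) : (ρ * matLog (r • A)).trace.re = Real.log r + (ρ * matLog A).trace.re := by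
  rw [matLog_smul hA hr, Matrix.mul_add, Matrix.trace_add, Complex.add_re, Matrix.mul_smul,
    Matrix.mul_one, Matrix.trace_smul, hρ]
  simp

/-- Shrinking the second argument by a factor increases the shifted relative entropy by at most
the logarithm of that factor. -/
lemma shiftedRelEnt_le_add_log {ρ σ τ : Matrix κ κ ℂ} (hρ : IsState ρ) (hσ : σ.PosSemidef)
    {w η : ℝ} (hw : 0 < w) (hw1 : w ≤ 1) (hη : 0 < η) (h : (τ - w • σ).PosSemidef) :
    shiftedRelEnt η ρ τ ≤ shiftedRelEnt η ρ σ + Real.log w⁻¹ := by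
  have hσ' := posDef_add_smul_one hσ hη
  have h1 : (τ + (η : ℂ) • (1 : Matrix κ κ ℂ) -
      w • (σ + (η : ℂ) • (1 : Matrix κ κ ℂ))).PosSemidef := by
    have e : τ + (η : ℂ) • (1 : Matrix κ κ ℂ) - w • (σ + (η : ℂ) • (1 : Matrix κ κ ℂ)) =
        (τ - w • σ) + ((1 - w) * η) • (1 : Matrix κ κ ℂ) := by
      rw [Complex.coe_smul]; module
    rw [e]
    exact h.add (Matrix.PosSemidef.one.smul (mul_nonneg (by linarith) hη.le))
  have h2 := trace_mul_matLog_mono hρ.1 (hσ'.smul hw) h1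
  rw [trace_mul_matLog_smul hρ.2 hσ' hw] at h2
  rw [shiftedRelEnt, shiftedRelEnt, trace_re_mul_sub, trace_re_mul_sub, Real.log_inv]
  linarith

lemma relEnt_le_add_log {ρ σ τ : Matrix κ κ ℂ} (hρ : IsState ρ) (hσ : σ.PosSemidef)
    (hτ : τ.PosSemidef) {w : ℝ} (hw : 0 < w) (hw1 : w ≤ 1) (h : (τ - w • σ).PosSemidef) :
    relEnt ρ τ ≤ relEnt ρ σ + (Real.log w⁻¹ : ℝ) := by
  refine EReal.ge_of_forall_gt_iff_ge.1 fun c hc => ?_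
  have hev := exists_lt_shiftedRelEnt hρ.1 hτ hc
  obtain ⟨η, hη, hη0⟩ := (hev.and self_mem_nhdsWithin).exists
  have h1 := shiftedRelEnt_le_add_log hρ hσ hw hw1 hη0 h
  have h2 := shiftedRelEnt_le_relEnt hρ.1 hσ hη0
  calc (c : EReal) ≤ ((shiftedRelEnt η ρ σ + Real.log w⁻¹ : ℝ) : EReal) := by
        exact_mod_cast hη.le.trans h1
    _ ≤ _ := by rw [EReal.coe_add]; gcongr

lemma matLog_self_le_add_smul_one {ρ : Matrix κ κ ℂ} (hρ : ρ.PosSemidef) {η : ℝ} (hη : 0 < η) :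
    (ρ * matLog ρ).trace.re ≤ (ρ * matLog (ρ + (η : ℂ) • (1 : Matrix κ κ ℂ))).trace.re := by
  rw [matLog_add_smul_one hρ.1, matLog_eq_cfc hρ.1, trace_mul_cfc hρ.1, trace_mul_cfc hρ.1]
  refine Finset.sum_le_sum fun j _ => ?_
  rcases (hρ.eigenvalues_nonneg j).eq_or_lt with h | h
  · have : basisWeight (hρ.1.eigenvectorUnitary : Matrix κ κ ℂ) ρ j = 0 := by
      have h2 := (suppLE_iff_basisWeight hρ hρ.1).1 le_rfl
      exact h2 j h.symm
    simp [this]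
  · exact mul_le_mul_of_nonneg_right (Real.log_le_log h (by linarith)) (basisWeight_nonneg hρ _ j)

/-- For commuting positive definite matrices `T`, `S` there is a positive definite `ω` with
`log ω = log T - log S` and `ω S = T`. -/
lemma exists_log_ratio {S T : Matrix κ κ ℂ} (hS : S.PosDef) (hT : T.PosDef) (hTS : Commute T S) :
    ∃ ω : Matrix κ κ ℂ, ω.PosDef ∧ matLog ω = matLog T - matLog S ∧ ω * S = T := by
  have hS' : IsStrictlyPositive S := Matrix.isStrictlyPositive_iff_posDef.2 hS
  have hT' : IsStrictlyPositive T := Matrix.isStrictlyPositive_iff_posDef.2 hT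
  have hc : Commute (CFC.log T) (CFC.log S) := by
    have h1 : Commute (CFC.log T) S := hTS.cfc_real _
    exact (h1.symm.cfc_real _).symm
  have hsa : IsSelfAdjoint (CFC.log T - CFC.log S) :=
    IsSelfAdjoint.log.sub IsSelfAdjoint.log
  set ω : Matrix κ κ ℂ := NormedSpace.exp (CFC.log T - CFC.log S) with hω
  have hωnn : ω.PosSemidef := Matrix.nonneg_iff_posSemidef.1 hsa.exp_nonneg
  have hmul : ω * S = T := by
    rw [hω]
    nth_rewrite 2 [← CFC.exp_log S hS']
    rw [← Matrix.exp_add_of_commute _ _ (hc.sub_left (Commute.refl _)), sub_add_cancel,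
      CFC.exp_log T hT']
  refine ⟨ω, (hωnn.posDef_iff_isUnit).2 (Matrix.isUnit_exp _), ?_, hmul⟩
  rw [matLog_eq_log hωnn.1, matLog_eq_log hT.1, matLog_eq_log hS.1]
  exact CFC.log_exp _ hsa

end LogMonotone

section TensorPow

set_option linter.unusedSectionVars false

variable {ι : Type*} [Fintype ι] [DecidableEq ι]

lemma tensorPow_mul (A B : MatC ι) (n : ℕ) :
    tensorPow (A * B) n = tensorPow A n * tensorPow B n := by
  ext i j
  simp only [tensorPow, Matrix.mul_apply, Finset.prod_univ_sum, Fintype.piFinset_univ,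
    Finset.prod_mul_distrib]

lemma tensorPow_conjTranspose (A : MatC ι) (n : ℕ) :
    tensorPow A.conjTranspose n = (tensorPow A n).conjTranspose := by
  ext i j
  simp [tensorPow, Matrix.conjTranspose_apply]

open scoped MatrixOrder Matrix.Norms.L2Operator in
lemma tensorPow_posSemidef {ρ : MatC ι} (hρ : ρ.PosSemidef) (n : ℕ) :
    (tensorPow ρ n).PosSemidef := by
  obtain ⟨B, rfl⟩ : ∃ B : MatC ι, ρ = B.conjTranspose * B :=
    CStarAlgebra.nonneg_iff_eq_star_mul_self.1 (Matrix.nonneg_iff_posSemidef.2 hρ)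
  rw [tensorPow_mul, tensorPow_conjTranspose]
  exact Matrix.posSemidef_conjTranspose_mul_self _

lemma trace_tensorPow (ρ : MatC ι) (n : ℕ) : (tensorPow ρ n).trace = ρ.trace ^ n := by
  simp only [Matrix.trace, Matrix.diag, tensorPow]
  rw [← Fin.prod_const n (∑ i, ρ i i), Finset.prod_univ_sum, Fintype.piFinset_univ]

lemma tensorPow_isState {ρ : MatC ι} (hρ : IsState ρ) (n : ℕ) : IsState (tensorPow ρ n) :=
  ⟨tensorPow_posSemidef hρ.1 n, by rw [trace_tensorPow, hρ.2, one_pow]⟩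

lemma convex_isState (κ : Type*) [Fintype κ] : Convex ℝ {ρ : Matrix κ κ ℂ | IsState ρ} := by
  rintro ρ ⟨hρ, hρ1⟩ σ ⟨hσ, hσ1⟩ a b ha hb hab
  refine ⟨(hρ.smul ha).add (hσ.smul hb), ?_⟩
  rw [Matrix.trace_add, Matrix.trace_smul, Matrix.trace_smul, hρ1, hσ1, ← add_smul, hab, one_smul]

lemma isState_of_mem_convexHull {C : Set (MatC ι)} (hC : ∀ ρ ∈ C, IsState ρ) {n : ℕ}
    {ρ : MatN ι n} (h : ρ ∈ convexHull ℝ (iidSet C n)) : IsState ρ := by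
  refine convexHull_min ?_ (convex_isState (Fin n → ι)) h
  rintro _ ⟨σ, hσ, rfl⟩
  exact tensorPow_isState (hC σ hσ) n

end TensorPow

section TestOperator

variable {ι : Type*} [Fintype ι] [DecidableEq ι]

/-- A polynomial in `n` bounding the dimension of the permutation invariant operators. -/
def polyBound (ι : Type*) [Fintype ι] (n : ℕ) : ℕ :=
  2 * (n + 1) ^ (Fintype.card ι * Fintype.card ι) + 1

lemma neg_log_card_le_entropy {K : ℕ} {p : Fin K → ℝ} (hp : ∀ k, 0 < p k) (hp1 : ∑ k, p k = 1) :
    -Real.log K ≤ ∑ k, p k * Real.log (p k) := by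
  have hK : (0 : ℝ) < K := by
    rcases Nat.eq_zero_or_pos K with rfl | h
    · simp at hp1
    · exact_mod_cast h
  have h : ∀ k, p k * (-Real.log K) + (p k - (K : ℝ)⁻¹) ≤ p k * Real.log (p k) := fun k => by
    have h1 := Real.log_le_sub_one_of_pos (inv_pos.2 (mul_pos hK (hp k)))
    rw [Real.log_inv, Real.log_mul hK.ne' (hp k).ne'] at h1
    have h2 := mul_le_mul_of_nonneg_left h1 (hp k).le
    have h3 : p k * ((K * p k)⁻¹ - 1) = (K : ℝ)⁻¹ - p k := by
      have := (hp k).ne'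
      field_simp
    rw [h3] at h2
    linarith
  have h2 := Finset.sum_le_sum fun k (_ : k ∈ Finset.univ) => h k
  rw [Finset.sum_add_distrib, ← Finset.sum_mul, Finset.sum_sub_distrib, hp1] at h2
  simpa [hK.ne'] using h2

lemma trace_sum_smul_mul {κ : Type*} [Fintype κ] {K : ℕ} (p : Fin K → ℝ)
    (z : Fin K → Matrix κ κ ℂ) (M : Matrix κ κ ℂ) :
    ((∑ k, p k • z k) * M).trace.re = ∑ k, p k * (z k * M).trace.re := by
  rw [Finset.sum_mul, Matrix.trace_sum, Complex.re_sum]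
  refine Finset.sum_congr rfl fun k _ => ?_
  rw [Matrix.smul_mul, Matrix.trace_smul, Complex.smul_re, smul_eq_mul]

/-- For mixtures of i.i.d. states, a uniform lower bound on the relative entropies produces an
operator witnessing it up to polynomial corrections. -/
lemma exists_test_operator {A B : Set (MatC ι)} (hA : ∀ ρ ∈ A, IsState ρ)
    (hB : ∀ σ ∈ B, IsState σ) {n : ℕ} {ρ σ : MatN ι n} (hρ : ρ ∈ convexHull ℝ (iidSet A n))
    (hσ : σ ∈ convexHull ℝ (iidSet B n)) {c : ℝ}
    (hc : ∀ τ ∈ A, (c : EReal) < relEnt (tensorPow τ n) σ) :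
    ∃ ω : MatN ι n, ω.PosDef ∧
      c - 2 * Real.log (polyBound ι n) - 1 < (ρ * matLog ω).trace.re + 1 - (σ * ω).trace.re := by
  have hρs := isState_of_mem_convexHull hA hρ
  have hσs := isState_of_mem_convexHull hB hσ
  obtain ⟨K, z, p, hz, hp, hp1, hzρ, hK⟩ := exists_decomp_of_mem_convexHull hρ
  have hzs : ∀ k, IsState (tensorPow (z k) n) := fun k => tensorPow_isState (hA _ (hz k)) n
  have hev1 : ∀ᶠ η in 𝓝[>] (0 : ℝ), ∀ k, c < shiftedRelEnt η (tensorPow (z k) n) σ :=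
    eventually_all.2 fun k => exists_lt_shiftedRelEnt (hzs k).1 hσs.1 (hc _ (hz k))
  have hev2 : ∀ᶠ η : ℝ in 𝓝[>] 0, η * Fintype.card (Fin n → ι) < 1 := by
    have : Tendsto (fun η : ℝ => η * Fintype.card (Fin n → ι)) (𝓝[>] 0)
        (𝓝 (0 * Fintype.card (Fin n → ι))) :=
      Tendsto.mono_left (Continuous.tendsto (by fun_prop) 0) nhdsWithin_le_nhds
    rw [zero_mul] at this
    exact this.eventually_lt_const one_pos
  obtain ⟨η, ⟨h1, h2⟩, hη⟩ := ((hev1.and hev2).and self_mem_nhdsWithin).exists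
  replace hη : 0 < η := hη
  set τ := pinch hσs.1.1 ρ with hτ
  set v := (Finset.univ.image hσs.1.1.eigenvalues).card with hv
  have hτps : τ.PosSemidef := pinch_posSemidef hσs.1.1 hρs.1
  set T := τ + (η : ℂ) • (1 : MatN ι n) with hT
  set S := σ + (η : ℂ) • (1 : MatN ι n) with hS
  have hTS : Commute T S := by
    have h : Commute τ σ := pinch_commute hσs.1.1 ρ
    have h1 : ∀ M : MatN ι n, Commute M ((η : ℂ) • (1 : MatN ι n)) := fun M =>
      (Commute.one_right M).smul_right _
    exact (h.add_right (h1 τ)).add_left (h1 _).symm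
  obtain ⟨ω, hω, hlog, hmul⟩ := exists_log_ratio (posDef_add_smul_one hσs.1 hη)
    (posDef_add_smul_one hτps hη) hTS
  refine ⟨ω, hω, ?_⟩
  have hvK : v ≤ polyBound ι n := by
    have := card_image_eigenvalues_le (convexHull_subset_symSubalgebra hσ) hσs.1.1
    rw [polyBound]
    lia
  have hv0 : 0 < v := by
    have hne : Nonempty (Fin n → ι) := by
      by_contra h
      rw [not_nonempty_iff] at h
      have := hσs.2
      simp [Matrix.trace] at this
    exact Finset.card_pos.2 (Finset.univ_nonempty.image _)
  have hK0 : 0 < K := by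
    rcases Nat.eq_zero_or_pos K with rfl | h
    · simp at hp1
    · exact h
  have hKb : Real.log K ≤ Real.log (polyBound ι n) :=
    Real.log_le_log (by exact_mod_cast hK0) (by exact_mod_cast hK)
  have hvb : Real.log v ≤ Real.log (polyBound ι n) :=
    Real.log_le_log (by exact_mod_cast hv0) (by exact_mod_cast hvK)
  have hple : ∀ k, p k ≤ 1 := fun k => by
    rw [← hp1]; exact Finset.single_le_sum (fun l _ => (hp l).le) (Finset.mem_univ k)
  have hk : ∀ k, c - Real.log v + Real.log (p k) ≤ (tensorPow (z k) n * matLog ω).trace.re := by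
    intro k
    set ρk := tensorPow (z k) n with hρk
    have hr : 0 < v / p k := div_pos (by exact_mod_cast hv0) (hp k)
    have hr1 : 1 ≤ v / p k := by
      rw [one_le_div (hp k)]
      exact (hple k).trans (by exact_mod_cast hv0)
    have hsub : (ρ - p k • ρk).PosSemidef := by
      have e : ρ - p k • ρk = ∑ l ∈ Finset.univ.erase k, p l • tensorPow (z l) n := by
        rw [← hzρ, ← Finset.add_sum_erase _ _ (Finset.mem_univ k), add_sub_cancel_left]
      rw [e]
      exact Matrix.posSemidef_sum _ fun l _ => (hzs l).1.smul (hp l).le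
    have hps : ((v / p k) • T - (ρk + (η : ℂ) • (1 : MatN ι n))).PosSemidef := by
      have e : (v / p k) • T - (ρk + (η : ℂ) • (1 : MatN ι n)) =
          (p k)⁻¹ • ((v : ℝ) • τ - ρ) + (p k)⁻¹ • (ρ - p k • ρk) +
            ((v / p k - 1) * η) • (1 : MatN ι n) := by
        have hpk : (p k)⁻¹ • p k • ρk = ρk := inv_smul_smul₀ (hp k).ne' _
        rw [hT, Complex.coe_smul, smul_sub _ ρ, hpk, div_eq_inv_mul]
        module
      rw [e]
      have hpi : 0 ≤ (p k)⁻¹ := inv_nonneg.2 (hp k).le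
      exact (((pinching_inequality hσs.1.1 hρs.1).smul hpi).add (hsub.smul hpi)).add
        (Matrix.PosSemidef.one.smul (mul_nonneg (by linarith) hη.le))
    have h3 := trace_mul_matLog_mono (hzs k).1 (posDef_add_smul_one (hzs k).1 hη) hps
    rw [trace_mul_matLog_smul (hzs k).2 (posDef_add_smul_one hτps hη) hr] at h3
    have h4 := matLog_self_le_add_smul_one (hzs k).1 hη
    have h5 := h1 k
    rw [shiftedRelEnt, trace_re_mul_sub] at h5
    rw [hlog, trace_re_mul_sub]
    rw [Real.log_div (by exact_mod_cast hv0.ne') (hp k).ne'] at h3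
    linarith
  have hlogρ : c - Real.log v - Real.log K ≤ (ρ * matLog ω).trace.re := by
    rw [← hzρ, trace_sum_smul_mul]
    have h3 := Finset.sum_le_sum fun k (_ : k ∈ Finset.univ) =>
      mul_le_mul_of_nonneg_left (hk k) (hp k).le
    simp only [mul_add, Finset.sum_add_distrib, ← Finset.sum_mul, hp1, one_mul] at h3
    have h4 := neg_log_card_le_entropy hp hp1
    linarith
  have hσω : (σ * ω).trace.re ≤ 1 + η * Fintype.card (Fin n → ι) := by
    have e1 : (ω * S).trace.re = 1 + η * Fintype.card (Fin n → ι) := by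
      rw [hmul, Matrix.trace_add, trace_pinch, hρs.2, Matrix.trace_smul, Matrix.trace_one,
        Complex.add_re, Complex.one_re, smul_eq_mul, Complex.re_ofReal_mul, Complex.natCast_re]
    have e2 : (ω * S).trace.re = (σ * ω).trace.re + η * ω.trace.re := by
      rw [hS, Matrix.mul_add, Matrix.trace_add, Matrix.mul_smul, Matrix.mul_one,
        Matrix.trace_smul, Matrix.trace_mul_comm, Complex.add_re, smul_eq_mul,
        Complex.re_ofReal_mul]
    have e3 : 0 ≤ ω.trace.re := (Complex.le_def.1 hω.posSemidef.trace_nonneg).1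
    have := mul_nonneg hη.le e3
    linarith
  linarith

end TestOperator

section Compactness

set_option linter.unusedSectionVars false

lemma isCompact_convexHull_of_isCompact {E : Type*} [AddCommGroup E] [Module ℝ E]
    [FiniteDimensional ℝ E] [TopologicalSpace E] [ContinuousAdd E] [ContinuousSMul ℝ E]
    {s : Set E} (hs : IsCompact s) : IsCompact (convexHull ℝ s) := by
  rcases s.eq_empty_or_nonempty with rfl | ⟨e₀, he₀⟩
  · simp
  set N := Module.finrank ℝ E + 1
  have hK : IsCompact (stdSimplex ℝ (Fin N) ×ˢ Set.pi Set.univ fun _ : Fin N => s) :=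
    (isCompact_stdSimplex ℝ (Fin N)).prod (isCompact_univ_pi fun _ => hs)
  have hf : Continuous fun x : (Fin N → ℝ) × (Fin N → E) => ∑ k, x.1 k • x.2 k := by fun_prop
  convert hK.image hf
  ext x
  constructor
  · intro hx
    obtain ⟨J, hJ, z, p, hz, hind, hp, hp1, rfl⟩ := eq_pos_convex_span_of_mem_convexHull hx
    have hcard : Fintype.card J ≤ Fintype.card (Fin N) := by
      rw [Fintype.card_fin]
      exact hind.card_le_finrank_succ.trans (Nat.succ_le_succ (Submodule.finrank_le _))
    obtain ⟨e⟩ := Function.Embedding.nonempty_of_card_le hcard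
    refine ⟨(Function.extend e p 0, Function.extend e z fun _ => e₀), ⟨⟨fun k => ?_, ?_⟩,
      fun k _ => ?_⟩, ?_⟩
    · by_cases h : ∃ j, e j = k
      · obtain ⟨j, rfl⟩ := h
        simp only [e.injective.extend_apply]
        exact (hp j).le
      · simp [Function.extend_apply' _ _ _ h]
    · rw [← hp1]
      exact (Fintype.sum_of_injective e e.injective p (Function.extend e p 0)
        (fun k hk => by rw [Function.extend_apply' _ _ _ hk]; rfl)
        fun j => (e.injective.extend_apply _ _ j).symm).symm
    · by_cases h : ∃ j, e j = k
      · obtain ⟨j, rfl⟩ := h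
        simp only [e.injective.extend_apply]
        exact hz ⟨j, rfl⟩
      · simpa only [Function.extend_apply' _ _ _ h] using he₀
    · refine (Fintype.sum_of_injective e e.injective _ _ (fun k hk => ?_) fun j => ?_).symm
      · simp [Function.extend_apply' p _ _ hk]
      · simp [e.injective.extend_apply]
  · rintro ⟨⟨p, z⟩, ⟨hp, hz⟩, rfl⟩
    exact (convex_convexHull ℝ s).sum_mem (fun k _ => hp.1 k) hp.2 fun k _ =>
      subset_convexHull ℝ s (hz k trivial)

open scoped MatrixOrder Matrix.Norms.L2Operator in
lemma norm_entry_le_one {κ : Type*} [Fintype κ] [DecidableEq κ] {ρ : Matrix κ κ ℂ}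
    (hρ : IsState ρ) (i j : κ) : ‖ρ i j‖ ≤ 1 := by
  obtain ⟨B, hB⟩ : ∃ B : Matrix κ κ ℂ, ρ = B.conjTranspose * B :=
    CStarAlgebra.nonneg_iff_eq_star_mul_self.1 (Matrix.nonneg_iff_posSemidef.2 hρ.1)
  have hdiag : ∀ i, (ρ i i).re = ∑ k, ‖B k i‖ ^ 2 := fun i => by
    rw [hB, Matrix.mul_apply, Complex.re_sum]
    refine Finset.sum_congr rfl fun k _ => ?_
    rw [Matrix.conjTranspose_apply, Complex.star_def, mul_comm, Complex.mul_conj,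
      Complex.ofReal_re, Complex.normSq_eq_norm_sq]
  have hle : ∀ i, (ρ i i).re ≤ 1 := fun i => by
    have h1 : ∑ i, (ρ i i).re = 1 := by
      have := congrArg Complex.re hρ.2
      rwa [Matrix.trace, Complex.re_sum] at this
    rw [← h1]
    refine Finset.single_le_sum (f := fun i => (ρ i i).re) (fun k _ => ?_) (Finset.mem_univ i)
    rw [hdiag]
    positivity
  calc ‖ρ i j‖ ≤ ∑ k, ‖B k i‖ * ‖B k j‖ := by
        rw [hB, Matrix.mul_apply]
        refine (norm_sum_le _ _).trans (le_of_eq ?_)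
        refine Finset.sum_congr rfl fun k _ => ?_
        rw [Matrix.conjTranspose_apply, norm_mul, norm_star]
    _ ≤ ∑ k, (‖B k i‖ ^ 2 / 2 + ‖B k j‖ ^ 2 / 2) :=
        Finset.sum_le_sum fun k _ => by nlinarith [sq_nonneg (‖B k i‖ - ‖B k j‖)]
    _ = (ρ i i).re / 2 + (ρ j j).re / 2 := by
        rw [Finset.sum_add_distrib, ← Finset.sum_div, ← Finset.sum_div, hdiag, hdiag]
    _ ≤ 1 := by linarith [hle i, hle j]

variable {ι : Type*} [Fintype ι] [DecidableEq ι]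

lemma isCompact_of_isState {A : Set (MatC ι)} (hA : ∀ ρ ∈ A, IsState ρ) (hcl : IsClosed A) :
    IsCompact A := by
  have hK : IsCompact (Set.pi Set.univ fun _ : ι => Set.pi Set.univ fun _ : ι =>
      Metric.closedBall (0 : ℂ) 1) :=
    isCompact_univ_pi fun _ => isCompact_univ_pi fun _ => isCompact_closedBall 0 1
  refine hK.of_isClosed_subset hcl fun ρ hρ i _ j _ => ?_
  rw [mem_closedBall_zero_iff]
  exact norm_entry_le_one (hA ρ hρ) i j

lemma continuous_tensorPow (n : ℕ) : Continuous fun ρ : MatC ι => tensorPow ρ n := by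
  refine continuous_matrix fun i j => ?_
  exact continuous_finsetProd _ fun k _ => continuous_id.matrix_elem (i k) (j k)

lemma isCompact_iidSet {A : Set (MatC ι)} (hA : ∀ ρ ∈ A, IsState ρ) (hcl : IsClosed A) (n : ℕ) :
    IsCompact (iidSet A n) := by
  convert (isCompact_of_isState hA hcl).image (continuous_tensorPow n)
  ext ρ
  simp [iidSet, eq_comm]

end Compactness

section Minimax

open scoped MatrixOrder Matrix.Norms.L2Operator

variable {ι : Type*} [Fintype ι] [DecidableEq ι]

lemma continuous_trace_re_mul_left {κ : Type*} [Fintype κ] (M : Matrix κ κ ℂ) :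
    Continuous fun X : Matrix κ κ ℂ => (X * M).trace.re :=
  Complex.continuous_re.comp (continuous_id.matrix_mul continuous_const).matrix_trace

lemma continuous_trace_re_mul_right {κ : Type*} [Fintype κ] (M : Matrix κ κ ℂ) :
    Continuous fun X : Matrix κ κ ℂ => (M * X).trace.re :=
  Complex.continuous_re.comp (continuous_const.matrix_mul continuous_id).matrix_trace

lemma trace_re_combo_mul {κ : Type*} [Fintype κ] (a b : ℝ) (X Y M : Matrix κ κ ℂ) :
    ((a • X + b • Y) * M).trace.re = a * (X * M).trace.re + b * (Y * M).trace.re := by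
  rw [Matrix.add_mul, Matrix.trace_add, Matrix.smul_mul, Matrix.smul_mul, Matrix.trace_smul,
    Matrix.trace_smul, Complex.add_re, Complex.smul_re, Complex.smul_re, smul_eq_mul, smul_eq_mul]

lemma trace_re_mul_combo {κ : Type*} [Fintype κ] (a b : ℝ) (X Y M : Matrix κ κ ℂ) :
    (M * (a • X + b • Y)).trace.re = a * (M * X).trace.re + b * (M * Y).trace.re := by
  rw [Matrix.trace_mul_comm, trace_re_combo_mul, Matrix.trace_mul_comm X, Matrix.trace_mul_comm Y]

/-- The witnessing operator can be chosen uniformly over both hypotheses. -/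
lemma exists_uniform_operator {A B : Set (MatC ι)} (hA : ∀ ρ ∈ A, IsState ρ)
    (hA_ne : A.Nonempty) (hA_cl : IsClosed A) (hB : ∀ σ ∈ B, IsState σ) (hB_ne : B.Nonempty)
    (hB_cl : IsClosed B) {n : ℕ} {c : ℝ}
    (hc : ∀ σ ∈ convexHull ℝ (iidSet B n), ∀ τ ∈ A, (c : EReal) < relEnt (tensorPow τ n) σ) :
    ∃ ω : MatN ι n, ω.PosDef ∧ ∀ ρ ∈ A, ∀ σ ∈ B, c - 2 * Real.log (polyBound ι n) - 1 <
      (tensorPow ρ n * matLog ω).trace.re + 1 - (tensorPow σ n * ω).trace.re := by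
  set t := c - 2 * Real.log (polyBound ι n) - 1
  set X : Set (MatN ι n × MatN ι n) := convexHull ℝ (iidSet A n) ×ˢ convexHull ℝ (iidSet B n)
  set Y : Set (MatN ι n) := {ω | IsStrictlyPositive ω}
  set f : MatN ι n × MatN ι n → MatN ι n → ℝ := fun x ω =>
    (x.1 * CFC.log ω).trace.re + 1 - (x.2 * ω).trace.re with hf
  have hmemA : ∀ ρ ∈ A, tensorPow ρ n ∈ convexHull ℝ (iidSet A n) := fun ρ hρ =>
    subset_convexHull ℝ _ ⟨ρ, hρ, rfl⟩
  have hmemB : ∀ σ ∈ B, tensorPow σ n ∈ convexHull ℝ (iidSet B n) := fun σ hσ =>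
    subset_convexHull ℝ _ ⟨σ, hσ, rfl⟩
  have neX : X.Nonempty := by
    obtain ⟨a, ha⟩ := hA_ne
    obtain ⟨b, hb⟩ := hB_ne
    exact ⟨(tensorPow a n, tensorPow b n), hmemA a ha, hmemB b hb⟩
  have kX : IsCompact X := (isCompact_convexHull_of_isCompact (isCompact_iidSet hA hA_cl n)).prod
    (isCompact_convexHull_of_isCompact (isCompact_iidSet hB hB_cl n))
  have cX : Convex ℝ X := (convex_convexHull ℝ _).prod (convex_convexHull ℝ _)
  have hcont : ∀ ω, Continuous fun x => f x ω := fun ω =>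
    (((continuous_trace_re_mul_left _).comp continuous_fst).add continuous_const).sub
      ((continuous_trace_re_mul_left _).comp continuous_snd)
  have hpt : ∀ x, ∃ ω ∈ Y, x ∈ X → t < f x ω := by
    rintro ⟨ρ, σ⟩
    by_cases hx : (ρ, σ) ∈ X
    · obtain ⟨ω, hω, h⟩ := exists_test_operator hA hB hx.1 hx.2 (hc σ hx.2)
      refine ⟨ω, Matrix.isStrictlyPositive_iff_posDef.2 hω, fun _ => ?_⟩
      rwa [matLog_eq_log hω.1] at h
    · exact ⟨1, Matrix.isStrictlyPositive_iff_posDef.2 Matrix.PosDef.one, fun h => absurd h hx⟩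
  choose g hgY hg using hpt
  obtain ⟨F, hFX, hF⟩ := kX.elim_nhds_subcover (fun x => {x' | t < f x' (g x)}) fun x hx =>
    (isOpen_lt continuous_const (hcont (g x))).mem_nhds (hg x hx)
  obtain ⟨ω, hω, h⟩ := Sion.exists_lt_iInf_of_lt_iInf_of_finite (f := f) (X := X) (Y := Y) neX kX
    (fun ω _ => (hcont ω).lowerSemicontinuous.lowerSemicontinuousOn X)
    (fun ω _ => ConvexOn.quasiconvexOn ⟨cX, fun x _ y _ a b _ _ hab => le_of_eq <| by
      simp only [hf, Prod.fst_add, Prod.snd_add, Prod.smul_fst, Prod.smul_snd,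
        trace_re_combo_mul, smul_eq_mul]
      linear_combination (-1 : ℝ) * hab⟩)
    CFC.concaveOn_log.1
    (fun x _ => by
      refine ContinuousOn.upperSemicontinuousOn ?_
      refine (ContinuousOn.add ?_ continuousOn_const).sub
        (continuous_trace_re_mul_right _).continuousOn
      refine (continuous_trace_re_mul_right x.1).comp_continuousOn
        (CFC.continuousOn_log.mono fun ω hω => ?_)
      exact ⟨hω.isSelfAdjoint, hω.isUnit⟩)
    (fun x hx => ConcaveOn.quasiconcaveOn ⟨CFC.concaveOn_log.1, fun y hy z hz a b ha hb hab => by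
      have h1 := CFC.concaveOn_log.2 hy hz ha hb hab
      rw [Matrix.le_iff] at h1
      have h2 := trace_mul_nonneg (isState_of_mem_convexHull hA hx.1).1 h1
      rw [trace_re_mul_sub, trace_re_mul_combo] at h2
      simp only [hf, trace_re_mul_combo, smul_eq_mul]
      linarith⟩)
    cX (F.finite_toSet.image g) (by rintro _ ⟨x, -, rfl⟩; exact hgY x)
    (t := t) (fun x hx => by
      obtain ⟨y, hy, hxy⟩ := Set.mem_iUnion₂.1 (hF hx)
      exact ⟨g y, ⟨y, hy, rfl⟩, hxy⟩)
  have hω' : ω.PosDef := Matrix.isStrictlyPositive_iff_posDef.1 hω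
  refine ⟨ω, hω', fun ρ hρ σ hσ => ?_⟩
  rw [matLog_eq_log hω'.1]
  exact h (tensorPow ρ n, tensorPow σ n) ⟨hmemA ρ hρ, hmemB σ hσ⟩

end Minimax

section BlockTest

set_option linter.unusedSectionVars false

variable {κ : Type*} [Fintype κ] [DecidableEq κ]

lemma sum_tensor_threshold_le {p : κ → ℝ} (hp : ∀ x, 0 ≤ p x) (g : κ → ℝ) (m : ℕ)
    {P : (Fin m → κ) → Prop} (hP : ∀ x, P x → 0 ≤ ∑ b, g (x b)) :
    ∑ x : Fin m → κ, (if P x then 1 else 0) * ∏ b, p (x b) ≤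
      (∑ x, p x * Real.exp (g x)) ^ m := by
  rw [← Fin.prod_const m (∑ x, p x * Real.exp (g x)), Finset.prod_univ_sum, Fintype.piFinset_univ]
  refine Finset.sum_le_sum fun x _ => ?_
  rw [Finset.prod_mul_distrib, ← Real.exp_sum, mul_comm]
  refine mul_le_mul_of_nonneg_left ?_ (Finset.prod_nonneg fun b _ => hp _)
  split_ifs with h
  · exact Real.one_le_exp (hP x h)
  · exact (Real.exp_pos _).le

lemma exists_chernoff_bound (h : κ → ℝ) (a : ℝ) {δ : ℝ} (hδ : 0 < δ) :
    ∃ t q : ℝ, 0 < t ∧ 0 ≤ q ∧ q < 1 ∧ ∀ p : κ → ℝ, (∀ x, 0 ≤ p x) → ∑ x, p x = 1 →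
      a ≤ ∑ x, h x * p x → ∑ x, p x * Real.exp (t * (a - δ - h x)) ≤ q := by
  set K := 1 + δ + ∑ x, |a - δ - h x| with hK
  have hK0 : 1 + δ ≤ K := le_add_of_nonneg_right (Finset.sum_nonneg fun x _ => abs_nonneg _)
  have hKh : ∀ x, |a - δ - h x| ≤ K := fun x => by
    have := Finset.single_le_sum (f := fun x => |a - δ - h x|) (fun _ _ => abs_nonneg _)
      (Finset.mem_univ x)
    linarith
  have hKp : 0 < K := by linarith
  set t := δ / (2 * K ^ 2) with ht
  have htp : 0 < t := by positivity
  have htK : t * K ^ 2 = δ / 2 := by rw [ht]; field_simp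
  have htK1 : t * K ≤ 1 := by nlinarith
  have htd : t * δ ≤ 1 := by nlinarith
  refine ⟨t, 1 - t * δ / 2, htp, by linarith, by nlinarith, fun p hp hp1 hpa => ?_⟩
  have key : ∀ x, p x * Real.exp (t * (a - δ - h x)) ≤
      p x * (1 + t * (a - δ) + t * δ / 2) - t * (h x * p x) := fun x => by
    have h1 : |t * (a - δ - h x)| ≤ t * K := by
      rw [abs_mul, abs_of_pos htp]
      exact mul_le_mul_of_nonneg_left (hKh x) htp.le
    have h2 := (abs_le.1 (Real.abs_exp_sub_one_sub_id_le (h1.trans htK1))).2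
    have h3 : (t * (a - δ - h x)) ^ 2 ≤ t * δ / 2 := by
      rw [← sq_abs]
      calc |t * (a - δ - h x)| ^ 2 ≤ (t * K) ^ 2 := by gcongr
        _ = t * (t * K ^ 2) := by ring
        _ = t * δ / 2 := by rw [htK]; ring
    have h4 : Real.exp (t * (a - δ - h x)) ≤ 1 + t * (a - δ - h x) + t * δ / 2 := by linarith
    calc _ ≤ p x * (1 + t * (a - δ - h x) + t * δ / 2) := mul_le_mul_of_nonneg_left h4 (hp x)
      _ = _ := by ring
  refine (Finset.sum_le_sum fun x _ => key x).trans ?_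
  rw [Finset.sum_sub_distrib, ← Finset.sum_mul, ← Finset.mul_sum, hp1]
  nlinarith

lemma basisWeight_tensorPow {τ : MatC κ} (hτ : τ.PosSemidef) (U : MatC κ) (m : ℕ)
    (x : Fin m → κ) :
    basisWeight (tensorPow U m) (tensorPow τ m) x = ∏ b, basisWeight U τ (x b) := by
  have h : ∀ y, (star U * τ * U) y y = (basisWeight U τ y : ℂ) := fun y => by
    have := (hτ.conjTranspose_mul_mul_same U).diag_nonneg (i := y)
    rw [Complex.le_def] at this
    refine Complex.ext rfl ?_
    rw [Complex.ofReal_im]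
    exact this.2.symm
  rw [basisWeight, Matrix.star_eq_conjTranspose, ← tensorPow_conjTranspose, ← tensorPow_mul,
    ← tensorPow_mul, tensorPow]
  rw [← Matrix.star_eq_conjTranspose]
  simp only [h]
  rw [← Complex.ofReal_prod, Complex.ofReal_re]

lemma tensorPow_one (m : ℕ) : tensorPow (1 : MatC κ) m = 1 := by
  ext x y
  rw [tensorPow, Matrix.one_apply]
  split_ifs with h
  · subst h
    exact Finset.prod_eq_one fun b _ => Matrix.one_apply_eq _
  · obtain ⟨b, hb⟩ := Function.ne_iff.1 h
    exact Finset.prod_eq_zero (Finset.mem_univ b) (Matrix.one_apply_ne hb)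

/-- The projection onto the columns of a unitary `V` whose index satisfies `P`. -/
def basisTest (V : Matrix κ κ ℂ) (P : κ → Prop) : Matrix κ κ ℂ :=
  V * Matrix.diagonal (fun x => ((if P x then 1 else 0 : ℝ) : ℂ)) * star V

lemma basisTest_posSemidef (V : Matrix κ κ ℂ) (P : κ → Prop) : (basisTest V P).PosSemidef := by
  refine (Matrix.PosSemidef.diagonal fun x => ?_).mul_mul_conjTranspose_same V
  simp only [Pi.zero_apply]
  split_ifs <;> simp

lemma one_sub_basisTest {V : Matrix κ κ ℂ} (hV : V * star V = 1) (P : κ → Prop) :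
    1 - basisTest V P = basisTest V fun x => ¬ P x := by
  have h : basisTest V (fun x => ¬ P x) =
      V * (1 - Matrix.diagonal fun x => ((if P x then 1 else 0 : ℝ) : ℂ)) * star V := by
    rw [basisTest, ← Matrix.diagonal_one, Matrix.diagonal_sub]
    congr 3
    ext x
    by_cases hx : P x <;> simp [hx]
  rw [h, basisTest, Matrix.mul_sub, Matrix.sub_mul, Matrix.mul_one, hV]

lemma trace_mul_basisTest (V ρ : Matrix κ κ ℂ) (P : κ → Prop) :
    (ρ * basisTest V P).trace.re = ∑ x, (if P x then 1 else 0) * basisWeight V ρ x :=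
  trace_mul_conj_diagonal V ρ _

/-- The test thresholding the empirical mean of the log-eigenvalues of `ω` over `m` blocks. -/
lemma exists_block_test {ω : MatC κ} (hω : ω.PosDef) (a : ℝ) {δ ε : ℝ} (hδ : 0 < δ)
    (hε : 0 < ε) : ∀ᶠ m : ℕ in atTop, ∃ F : MatN κ m, F.PosSemidef ∧ (1 - F).PosSemidef ∧
      (∀ τ, IsState τ → a ≤ (τ * matLog ω).trace.re →
        (tensorPow τ m * (1 - F)).trace.re ≤ ε) ∧
      ∀ τ, IsState τ → (τ * ω).trace.re ≤ 1 →
        (tensorPow τ m * F).trace.re ≤ Real.exp (-(m * (a - δ))) := by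
  set U := (hω.1.eigenvectorUnitary : MatC κ)
  set h : κ → ℝ := fun x => Real.log (hω.1.eigenvalues x)
  obtain ⟨t, q, ht, hq0, hq1, hq⟩ := exists_chernoff_bound h a hδ
  have hqm : ∀ᶠ m : ℕ in atTop, q ^ m < ε :=
    (tendsto_pow_atTop_nhds_zero_of_lt_one hq0 hq1).eventually_lt_const hε
  filter_upwards [hqm] with m hm
  have hU : U * star U = 1 := eigenvectorUnitary_mul_star hω.1
  have hV : tensorPow U m * star (tensorPow U m) = 1 := by
    rw [Matrix.star_eq_conjTranspose, ← tensorPow_conjTranspose, ← tensorPow_mul,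
      ← Matrix.star_eq_conjTranspose, hU, tensorPow_one]
  refine ⟨basisTest (tensorPow U m) fun x => 0 ≤ ∑ b, (h (x b) - (a - δ)),
    basisTest_posSemidef _ _, ?_, fun τ hτ hτa => ?_, fun τ hτ hτ1 => ?_⟩
  · rw [one_sub_basisTest hV]
    exact basisTest_posSemidef _ _
  · rw [one_sub_basisTest hV, trace_mul_basisTest]
    simp only [basisWeight_tensorPow hτ.1]
    refine (sum_tensor_threshold_le (basisWeight_nonneg hτ.1 U) (fun x => t * (a - δ - h x)) m
      fun x hx => ?_).trans ((pow_le_pow_left₀ (Finset.sum_nonneg fun x _ => mul_nonneg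
        (basisWeight_nonneg hτ.1 U x) (Real.exp_pos _).le) (hq _ (basisWeight_nonneg hτ.1 U) ?_ ?_)
        m).trans hm.le)
    · rw [← Finset.mul_sum]
      refine mul_nonneg ht.le ?_
      have h1 : ∑ b, (a - δ - h (x b)) = -∑ b, (h (x b) - (a - δ)) := by
        rw [← Finset.sum_neg_distrib]
        simp
      rw [h1]
      exact neg_nonneg.2 (not_le.1 hx).le
    · rw [sum_basisWeight hU, hτ.2, Complex.one_re]
    · rwa [matLog_eq_cfc hω.1, trace_mul_cfc hω.1] at hτa
  · rw [trace_mul_basisTest]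
    simp only [basisWeight_tensorPow hτ.1]
    refine (sum_tensor_threshold_le (basisWeight_nonneg hτ.1 U) (fun x => h x - (a - δ)) m
      fun x hx => hx).trans ?_
    have h1 : ∑ x, basisWeight U τ x * Real.exp (h x - (a - δ)) ≤ Real.exp (-(a - δ)) := by
      have h2 : ∀ x, basisWeight U τ x * Real.exp (h x - (a - δ)) =
          hω.1.eigenvalues x * basisWeight U τ x * Real.exp (-(a - δ)) := fun x => by
        rw [sub_eq_add_neg, Real.exp_add, Real.exp_log (hω.eigenvalues_pos x)]
        ring
      rw [Finset.sum_congr rfl fun x _ => h2 x, ← Finset.sum_mul, ← trace_mul_conj_diagonal,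
        ← eq_conj_diagonal hω.1]
      exact mul_le_of_le_one_left (Real.exp_pos _).le hτ1
    refine (pow_le_pow_left₀ (Finset.sum_nonneg fun x _ => mul_nonneg
        (basisWeight_nonneg hτ.1 U x) (Real.exp_pos _).le) h1 m).trans (le_of_eq ?_)
    rw [← Real.exp_nat_mul]
    ring_nf

variable {ι : Type*} [Fintype ι] [DecidableEq ι]

/-- Indices of `m * n + r` copies, split into `m` blocks of `n` copies and a remainder. -/
def blockEquiv (ι : Type*) (m n r : ℕ) :
    (Fin (m * n + r) → ι) ≃ (Fin m → Fin n → ι) × (Fin r → ι) :=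
  ((Equiv.arrowCongr ((Equiv.sumCongr finProdFinEquiv (Equiv.refl _)).trans finSumFinEquiv)
    (Equiv.refl ι)).symm.trans (Equiv.sumArrowEquivProdArrow _ _ _)).trans
    (Equiv.prodCongr (Equiv.curry _ _ _) (Equiv.refl _))

lemma tensorPow_eq_submatrix_blockEquiv (ρ : MatC ι) (m n r : ℕ) :
    tensorPow ρ (m * n + r) =
      (Matrix.kroneckerMap (· * ·) (tensorPow (tensorPow ρ n) m) (tensorPow ρ r)).submatrix
        (blockEquiv ι m n r) (blockEquiv ι m n r) := by
  ext i j
  rw [tensorPow, ← Equiv.prod_comp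
    ((Equiv.sumCongr finProdFinEquiv (Equiv.refl (Fin r))).trans finSumFinEquiv),
    Fintype.prod_sum_type, Fintype.prod_prod_type]
  rfl

lemma trace_submatrix_equiv {κ₁ κ₂ : Type*} [Fintype κ₁] [Fintype κ₂] (e : κ₁ ≃ κ₂)
    (M : Matrix κ₂ κ₂ ℂ) : (M.submatrix e e).trace = M.trace :=
  Equiv.sum_comp e fun x => M x x

lemma trace_tensorPow_mul_block {ρ : MatC ι} (hρ : IsState ρ) (m n r : ℕ)
    (F : MatN (Fin n → ι) m) :
    (tensorPow ρ (m * n + r) * (Matrix.kroneckerMap (· * ·) F (1 : MatN ι r)).submatrix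
      (blockEquiv ι m n r) (blockEquiv ι m n r)).trace =
      (tensorPow (tensorPow ρ n) m * F).trace := by
  rw [tensorPow_eq_submatrix_blockEquiv, Matrix.submatrix_mul_equiv, trace_submatrix_equiv,
    ← Matrix.mul_kronecker_mul, Matrix.mul_one, Matrix.trace_kronecker, trace_tensorPow, hρ.2,
    one_pow, mul_one]

lemma typeII_le_of_test {A B : Set (Matrix κ κ ℂ)} (hB : ∀ σ ∈ B, IsState σ) {ε b : ℝ}
    (hb : 0 ≤ b) {E : Matrix κ κ ℂ} (hE : E.PosSemidef) (hE1 : (1 - E).PosSemidef)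
    (hA : ∀ ρ ∈ A, (ρ * (1 - E)).trace.re ≤ ε) (hBE : ∀ σ ∈ B, (σ * E).trace.re ≤ b) :
    typeII A B ε ≤ b := by
  refine le_trans (csInf_le ⟨0, ?_⟩ ⟨E, hE, hE1, hA, rfl⟩) (Real.sSup_le ?_ hb)
  · rintro _ ⟨E', hE', -, -, rfl⟩
    refine Real.sSup_nonneg ?_
    rintro _ ⟨σ, hσ, rfl⟩
    exact trace_mul_nonneg (hB σ hσ).1 hE'
  · rintro _ ⟨σ, hσ, rfl⟩
    exact hBE σ hσ

lemma typeII_iid_le {A B : Set (MatC ι)} (hA : ∀ ρ ∈ A, IsState ρ) (hB : ∀ σ ∈ B, IsState σ)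
    {n : ℕ} {ω : MatN ι n} (hω : ω.PosDef) {a : ℝ}
    (hAω : ∀ ρ ∈ A, a ≤ (tensorPow ρ n * matLog ω).trace.re)
    (hBω : ∀ σ ∈ B, (tensorPow σ n * ω).trace.re ≤ 1) {δ ε : ℝ} (hδ : 0 < δ) (hε : 0 < ε) :
    ∀ᶠ m : ℕ in atTop, ∀ r, typeII (iidSet A (m * n + r)) (iidSet B (m * n + r)) ε ≤
      Real.exp (-(m * (a - δ))) := by
  filter_upwards [exists_block_test hω a hδ hε] with m hm r
  obtain ⟨F, hF, hF1, hFA, hFB⟩ := hm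
  set e := blockEquiv ι m n r with he
  have hsub : 1 - (Matrix.kroneckerMap (· * ·) F (1 : MatN ι r)).submatrix e e =
      (Matrix.kroneckerMap (· * ·) (1 - F) (1 : MatN ι r)).submatrix e e := by
    have h : (1 : MatN ι (m * n + r)) = (Matrix.kroneckerMap (· * ·) (1 : MatN (Fin n → ι) m)
        (1 : MatN ι r)).submatrix e e := by
      rw [Matrix.one_kronecker_one, Matrix.submatrix_one_equiv]
    rw [h]
    ext i j
    simp only [Matrix.sub_apply, Matrix.submatrix_apply, Matrix.kroneckerMap_apply, sub_mul]
  refine typeII_le_of_test (E := (Matrix.kroneckerMap (· * ·) F (1 : MatN ι r)).submatrix e e)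
    ?_ (Real.exp_pos _).le ((hF.kronecker Matrix.PosSemidef.one).submatrix e) ?_ ?_ ?_
  · rintro _ ⟨σ, hσ, rfl⟩
    exact tensorPow_isState (hB σ hσ) _
  · rw [hsub]
    exact (hF1.kronecker Matrix.PosSemidef.one).submatrix e
  · rintro _ ⟨ρ, hρ, rfl⟩
    rw [hsub, he, trace_tensorPow_mul_block (hA ρ hρ)]
    exact hFA _ (tensorPow_isState (hA ρ hρ) n) (hAω ρ hρ)
  · rintro _ ⟨σ, hσ, rfl⟩
    rw [he, trace_tensorPow_mul_block (hB σ hσ)]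
    exact hFB _ (tensorPow_isState (hB σ hσ) n) (hBω σ hσ)

end BlockTest

section Achievability

lemma le_negLog_of_le_exp {x y : ℝ} (h : x ≤ Real.exp (-y)) : (y : EReal) ≤ negLog x := by
  rw [negLog]
  split_ifs with hx
  · exact le_top
  · rw [EReal.coe_le_coe_iff]
    have := (Real.log_le_log (not_le.1 hx) h).trans_eq (Real.log_exp _)
    linarith

lemma cFrac_mono (n : ℕ) {x y : EReal} (h : x ≤ y) : cFrac n * x ≤ cFrac n * y :=
  mul_le_mul_of_nonneg_left h (EReal.coe_nonneg.2 (inv_nonneg.2 n.cast_nonneg))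

variable {ι : Type*} [Fintype ι] [DecidableEq ι]

lemma le_steinExponent_of_operator {A B : Set (MatC ι)} (hA : ∀ ρ ∈ A, IsState ρ)
    (hB : ∀ σ ∈ B, IsState σ) {n : ℕ} (hn : 0 < n) {ω : MatN ι n} (hω : ω.PosDef) {a : ℝ}
    (hAω : ∀ ρ ∈ A, a ≤ (tensorPow ρ n * matLog ω).trace.re)
    (hBω : ∀ σ ∈ B, (tensorPow σ n * ω).trace.re ≤ 1) :
    ((a / n : ℝ) : EReal) ≤ steinExponent (iidSet A) (iidSet B) := by
  refine le_iInf₂ fun ε hε => EReal.ge_of_forall_gt_iff_ge.1 fun z hz => ?_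
  rw [EReal.coe_lt_coe_iff] at hz
  have hn' : (0 : ℝ) < n := Nat.cast_pos.2 hn
  set δ := (a - z * n) / 2 with hδ
  have hδ0 : 0 < δ := by
    have := (lt_div_iff₀ hn').1 hz
    linarith
  have hgap : z < (a - δ) / n := by
    rw [lt_div_iff₀ hn']
    linarith
  have hlim : Tendsto (fun N : ℕ => (a - δ) / n - |a - δ| / (N : ℝ)) atTop (𝓝 ((a - δ) / n)) := by
    simpa using tendsto_const_nhds.sub (tendsto_const_div_atTop_nhds_zero_nat |a - δ|)
  refine le_liminf_of_le (by isBoundedDefault) ?_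
  filter_upwards [(Nat.tendsto_div_const_atTop hn.ne').eventually
    (typeII_iid_le hA hB hω hAω hBω hδ0 hε.1), hlim.eventually_const_lt hgap,
    eventually_gt_atTop 0] with N hN hzN hN0
  specialize hN (N % n)
  rw [Nat.div_add_mod'] at hN
  refine le_trans ?_ (cFrac_mono N (le_negLog_of_le_exp hN))
  rw [cFrac, ← EReal.coe_mul, EReal.coe_le_coe_iff]
  refine hzN.le.trans ?_
  have hN' : (0 : ℝ) < N := Nat.cast_pos.2 hN0
  have hdm : ((N / n : ℕ) : ℝ) * n + ((N % n : ℕ) : ℝ) = N := by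
    exact_mod_cast Nat.div_add_mod' N n
  have hmod : ((N % n : ℕ) : ℝ) ≤ n := by exact_mod_cast (Nat.mod_lt N hn).le
  have hmod0 : (0 : ℝ) ≤ ((N % n : ℕ) : ℝ) := Nat.cast_nonneg _
  have hm : ((N / n : ℕ) : ℝ) = (N - ((N % n : ℕ) : ℝ)) / n := by
    rw [eq_div_iff hn'.ne']
    linarith
  have h1 : (N : ℝ)⁻¹ * (((N / n : ℕ) : ℝ) * (a - δ)) =
      (a - δ) / n - (((N % n : ℕ) : ℝ) / n) * (a - δ) / N := by
    rw [hm]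
    field_simp
  rw [h1]
  refine sub_le_sub_left (div_le_div_of_nonneg_right ?_ hN'.le) _
  have h2 : ((N % n : ℕ) : ℝ) / n ≤ 1 := (div_le_one hn').2 hmod
  have h3 : 0 ≤ ((N % n : ℕ) : ℝ) / n := by positivity
  calc _ ≤ ((N % n : ℕ) : ℝ) / n * |a - δ| := mul_le_mul_of_nonneg_left (le_abs_self _) h3
    _ ≤ |a - δ| := mul_le_of_le_one_left (abs_nonneg _) h2

/-- The regularised relative entropy to the convex hull of the i.i.d. alternatives is
achievable, up to a logarithmic correction. -/
lemma le_steinExponent {A B : Set (MatC ι)} (hA : ∀ ρ ∈ A, IsState ρ)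
    (hA_ne : A.Nonempty) (hA_cl : IsClosed A) (hB : ∀ σ ∈ B, IsState σ) (hB_ne : B.Nonempty)
    (hB_cl : IsClosed B) {n : ℕ} (hn : 0 < n) {c : ℝ}
    (hc : ∀ σ ∈ convexHull ℝ (iidSet B n), ∀ τ ∈ A, (c : EReal) < relEnt (tensorPow τ n) σ) :
    (((c - 2 * Real.log (polyBound ι n) - 2) / n : ℝ) : EReal) ≤
      steinExponent (iidSet A) (iidSet B) := by
  obtain ⟨ω, hω, h⟩ := exists_uniform_operator hA hA_ne hA_cl hB hB_ne hB_cl hc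
  have hcont : ContinuousOn (fun σ : MatC ι => (tensorPow σ n * ω).trace.re) B :=
    ((continuous_trace_re_mul_left ω).comp (continuous_tensorPow n)).continuousOn
  obtain ⟨σ₀, hσ₀, hmax⟩ := (isCompact_of_isState hB hB_cl).exists_isMaxOn hB_ne hcont
  set s := (tensorPow σ₀ n * ω).trace.re + 1 with hs
  have hs0 : 0 < s := by
    have := trace_mul_nonneg (tensorPow_posSemidef (hB σ₀ hσ₀).1 n) hω.posSemidef
    linarith
  refine le_steinExponent_of_operator hA hB hn (hω.smul (inv_pos.2 hs0)) (fun ρ hρ => ?_)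
    fun σ hσ => ?_
  · rw [trace_mul_matLog_smul (tensorPow_isState (hA ρ hρ) n).2 hω (inv_pos.2 hs0), Real.log_inv]
    have h1 := h ρ hρ σ₀ hσ₀
    have h2 := Real.log_le_sub_one_of_pos hs0
    linarith
  · rw [Matrix.mul_smul, Matrix.trace_smul, Complex.smul_re, smul_eq_mul, inv_mul_le_one₀ hs0]
    have h1 : (tensorPow σ n * ω).trace.re ≤ (tensorPow σ₀ n * ω).trace.re := hmax hσ
    linarith

end Achievability

section Mixtures

set_option linter.unusedSectionVars false

variable {ι : Type*} [Fintype ι] [DecidableEq ι]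

lemma measurable_tensorPow_entry {C : Set (MatC ι)} (n : ℕ) (i j : Fin n → ι) :
    Measurable fun σ : ↥C => tensorPow (σ : MatC ι) n i j := by
  refine Finset.measurable_prod _ fun k _ => ?_
  exact (measurable_pi_apply (j k)).comp ((measurable_pi_apply (i k)).comp measurable_subtype_coe)

lemma integrable_tensorPow_entry {C : Set (MatC ι)} (hC : ∀ σ ∈ C, IsState σ) (μ : Measure ↥C)
    [IsFiniteMeasure μ] (n : ℕ) (i j : Fin n → ι) :
    Integrable (fun σ : ↥C => tensorPow (σ : MatC ι) n i j) μ :=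
  Integrable.of_bound (measurable_tensorPow_entry n i j).aestronglyMeasurable 1
    (Eventually.of_forall fun σ => norm_entry_le_one (tensorPow_isState (hC σ σ.2) n) i j)

lemma integrable_trace_tensorPow_mul {C : Set (MatC ι)} (hC : ∀ σ ∈ C, IsState σ)
    (μ : Measure ↥C) [IsFiniteMeasure μ] (n : ℕ) (E : MatN ι n) :
    Integrable (fun σ : ↥C => (tensorPow (σ : MatC ι) n * E).trace) μ :=
  integrable_finsetSum _ fun i _ => integrable_finsetSum _ fun j _ =>
    (integrable_tensorPow_entry hC μ n i j).mul_const _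

lemma trace_iidMix_mul {C : Set (MatC ι)} (hC : ∀ σ ∈ C, IsState σ) (μ : Measure ↥C)
    [IsFiniteMeasure μ] (n : ℕ) (E : MatN ι n) :
    (iidMix μ n * E).trace = ∫ σ : ↥C, (tensorPow (σ : MatC ι) n * E).trace ∂μ := by
  have h : ∀ σ : ↥C, (tensorPow (σ : MatC ι) n * E).trace =
      ∑ i, ∑ j, tensorPow (σ : MatC ι) n i j * E j i := fun σ => rfl
  simp only [h]
  rw [integral_finsetSum _ fun i _ => integrable_finsetSum _ fun j _ =>
    (integrable_tensorPow_entry hC μ n i j).mul_const _]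
  refine Finset.sum_congr rfl fun i _ => ?_
  rw [integral_finsetSum _ fun j _ => (integrable_tensorPow_entry hC μ n i j).mul_const _]
  refine Finset.sum_congr rfl fun j _ => ?_
  rw [integral_mul_const]
  rfl

lemma trace_re_iidMix_mul {C : Set (MatC ι)} (hC : ∀ σ ∈ C, IsState σ) (μ : Measure ↥C)
    [IsFiniteMeasure μ] (n : ℕ) (E : MatN ι n) :
    (iidMix μ n * E).trace.re = ∫ σ : ↥C, (tensorPow (σ : MatC ι) n * E).trace.re ∂μ := by
  rw [trace_iidMix_mul hC]
  exact (integral_re (integrable_trace_tensorPow_mul hC μ n E)).symm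

lemma iidMix_isHermitian {C : Set (MatC ι)} (hC : ∀ σ ∈ C, IsState σ) (μ : Measure ↥C) (n : ℕ) :
    (iidMix μ n).IsHermitian := by
  ext i j
  rw [Matrix.conjTranspose_apply, iidMix, iidMix, Complex.star_def, ← integral_conj]
  refine integral_congr_ae (Eventually.of_forall fun σ => ?_)
  exact congrFun (congrFun (tensorPow_isState (hC σ σ.2) n).1.1 i) j

lemma posSemidef_of_trace_vecMulVec {κ : Type*} [Fintype κ] {M : Matrix κ κ ℂ}
    (hM : M.IsHermitian) (h : ∀ x, 0 ≤ (M * Matrix.vecMulVec x (star x)).trace.re) :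
    M.PosSemidef := by
  refine .of_dotProduct_mulVec_nonneg hM fun x => ?_
  rw [Complex.le_def]
  refine ⟨?_, (hM.im_star_dotProduct_mulVec_self x).symm⟩
  have := h x
  rwa [Matrix.mul_vecMulVec, Matrix.trace_vecMulVec, dotProduct_comm] at this

lemma iidMix_sub_posSemidef {C : Set (MatC ι)} (hC : ∀ σ ∈ C, IsState σ) {μ ν : Measure ↥C}
    [IsFiniteMeasure μ] [IsFiniteMeasure ν] (h : ν ≤ μ) (n : ℕ) :
    (iidMix μ n - iidMix ν n).PosSemidef := by
  refine posSemidef_of_trace_vecMulVec ((iidMix_isHermitian hC μ n).sub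
    (iidMix_isHermitian hC ν n)) fun x => ?_
  rw [Matrix.sub_mul, Matrix.trace_sub, Complex.sub_re, sub_nonneg, trace_re_iidMix_mul hC,
    trace_re_iidMix_mul hC]
  refine integral_mono_measure h (Eventually.of_forall fun σ => ?_)
    (integrable_trace_tensorPow_mul hC μ n _).re
  exact trace_mul_nonneg (tensorPow_isState (hC σ σ.2) n).1
    (Matrix.posSemidef_vecMulVec_self_star x)

lemma iidMix_isState {C : Set (MatC ι)} (hC : ∀ σ ∈ C, IsState σ) (μ : Measure ↥C)
    [IsProbabilityMeasure μ] (n : ℕ) : IsState (iidMix μ n) := by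
  constructor
  · have h := iidMix_sub_posSemidef hC (Measure.zero_le μ) n
    have h0 : iidMix (0 : Measure ↥C) n = 0 := by
      ext i j
      simp [iidMix]
    rwa [h0, sub_zero] at h
  · have h := trace_iidMix_mul hC μ n 1
    simp only [Matrix.mul_one] at h
    rw [h]
    have h1 : ∀ σ : ↥C, (tensorPow (σ : MatC ι) n).trace = 1 := fun σ =>
      (tensorPow_isState (hC σ σ.2) n).2
    simp [h1]

lemma iidMix_smul {C : Set (MatC ι)} (μ : Measure ↥C) {w : ℝ} (hw : 0 ≤ w) (n : ℕ) :
    iidMix (ENNReal.ofReal w • μ) n = w • iidMix μ n := by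
  ext i j
  rw [iidMix, integral_smul_measure, ENNReal.toReal_ofReal hw]
  rfl

/-- Every element of the convex hull of the i.i.d. states is a mixture. -/
lemma exists_iidMix_eq {C : Set (MatC ι)} (hC : ∀ σ ∈ C, IsState σ) {n : ℕ} {σ : MatN ι n}
    (h : σ ∈ convexHull ℝ (iidSet C n)) :
    ∃ μ : Measure ↥C, IsProbabilityMeasure μ ∧ iidMix μ n = σ := by
  obtain ⟨K, z, p, hz, hp, hp1, rfl, -⟩ := exists_decomp_of_mem_convexHull h
  refine ⟨∑ k, ENNReal.ofReal (p k) • Measure.dirac ⟨z k, hz k⟩, ⟨?_⟩, ?_⟩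
  · simp only [Measure.coe_finsetSum, Finset.sum_apply, Measure.smul_apply, measure_univ,
      smul_eq_mul, mul_one]
    rw [← ENNReal.ofReal_sum_of_nonneg fun k _ => (hp k).le, hp1, ENNReal.ofReal_one]
  · ext i j
    rw [iidMix, integral_finsetSum_measure fun k _ => ?_]
    · rw [Matrix.sum_apply]
      refine Finset.sum_congr rfl fun k _ => ?_
      rw [integral_smul_measure, ENNReal.toReal_ofReal (hp k).le]
      exact congrArg (p k • ·)
        (integral_dirac' _ _ (measurable_tensorPow_entry n i j).stronglyMeasurable)
    · exact (integrable_tensorPow_entry hC _ n i j).smul_measure ENNReal.ofReal_ne_top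

/-- A single mixing measure dominating a prescribed sequence of mixtures, up to
polynomially small weights. -/
lemma exists_dominating_measure {C : Set (MatC ι)} (hC : ∀ σ ∈ C, IsState σ)
    {σ : ∀ n, MatN ι n} (hσ : ∀ n, σ n ∈ convexHull ℝ (iidSet C n)) :
    ∃ (μ : Measure ↥C) (c : ℝ), IsProbabilityMeasure μ ∧ ∀ n : ℕ, ∃ w : ℝ, 0 < w ∧ w ≤ 1 ∧
      Real.log w⁻¹ ≤ c + 2 * Real.log (n + 1) ∧ (iidMix μ n - w • σ n).PosSemidef := by
  choose μ hμ hμσ using fun n => exists_iidMix_eq hC (hσ n)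
  set u : ℕ → ℝ := fun n => 1 / ((n : ℝ) + 1) ^ 2 with hu
  have hu0 : ∀ n, 0 < u n := fun n => by positivity
  have hus : Summable u := by
    have := (summable_nat_add_iff 1).2 (Real.summable_one_div_nat_pow.2 one_lt_two)
    simpa [hu] using this
  set T := ∑' n, u n with hT
  have hT0 : 0 < T := hus.tsum_pos (fun n => (hu0 n).le) 0 (hu0 0)
  set w : ℕ → ℝ := fun n => u n / T with hw
  have hw0 : ∀ n, 0 < w n := fun n => div_pos (hu0 n) hT0
  have hws : Summable w := hus.div_const T
  have hw1 : ∑' n, w n = 1 := by rw [tsum_div_const, div_self hT0.ne']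
  set ν : Measure ↥C := Measure.sum fun n => ENNReal.ofReal (w n) • μ n with hν
  have hνp : IsProbabilityMeasure ν := ⟨by
    rw [hν, Measure.sum_apply _ MeasurableSet.univ]
    simp only [Measure.smul_apply, measure_univ, smul_eq_mul, mul_one]
    rw [← ENNReal.ofReal_tsum_of_nonneg (fun n => (hw0 n).le) hws, hw1, ENNReal.ofReal_one]⟩
  refine ⟨ν, Real.log T, hνp, fun n => ⟨w n, hw0 n, ?_, le_of_eq ?_, ?_⟩⟩
  · rw [← hw1]
    exact hws.le_tsum n fun k _ => (hw0 k).le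
  · have h1 : (w n)⁻¹ = T * ((n : ℝ) + 1) ^ 2 := by
      simp only [hw, hu]
      field_simp
    rw [h1, Real.log_mul hT0.ne' (by positivity), Real.log_pow]
    norm_num
  · have hle : ENNReal.ofReal (w n) • μ n ≤ ν :=
      Measure.le_sum (fun n => ENNReal.ofReal (w n) • μ n) n
    have hfin : IsFiniteMeasure (ENNReal.ofReal (w n) • μ n) := isFiniteMeasure_of_le ν hle
    have h := iidMix_sub_posSemidef hC hle n
    rwa [iidMix_smul _ (hw0 n).le, hμσ] at h

end Mixtures

section Converse

variable {ι : Type*} [Fintype ι] [DecidableEq ι]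

lemma lt_mul_of_cFrac_mul_lt {n : ℕ} (hn : 0 < n) {x : EReal} {z : ℝ}
    (h : cFrac n * x < (z : EReal)) : x < ((n * z : ℝ) : EReal) := by
  by_contra! hx
  refine absurd (cFrac_mono n hx) (not_le.2 ?_)
  rwa [cFrac, ← EReal.coe_mul, inv_mul_cancel_left₀ (Nat.cast_ne_zero.2 hn.ne')]

lemma trace_re_iidMix_mul_le {C : Set (MatC ι)} (hC : ∀ σ ∈ C, IsState σ) (μ : Measure ↥C)
    [IsProbabilityMeasure μ] (n : ℕ) {E : MatN ι n} (hE1 : (1 - E).PosSemidef) :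
    (iidMix μ n * E).trace.re ≤ sSup {x : ℝ | ∃ σ ∈ iidSet C n, x = (σ * E).trace.re} := by
  have hbdd : BddAbove {x : ℝ | ∃ σ ∈ iidSet C n, x = (σ * E).trace.re} := by
    refine ⟨1, ?_⟩
    rintro _ ⟨_, ⟨σ, hσ, rfl⟩, rfl⟩
    have h := trace_mul_nonneg (tensorPow_isState (hC σ hσ) n).1 hE1
    rw [trace_re_mul_sub, Matrix.mul_one, (tensorPow_isState (hC σ hσ) n).2, Complex.one_re] at h
    linarith
  rw [trace_re_iidMix_mul hC]
  refine (integral_mono (integrable_trace_tensorPow_mul hC μ n E).re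
    (integrable_const (sSup {x : ℝ | ∃ σ ∈ iidSet C n, x = (σ * E).trace.re})) fun σ =>
      le_csSup hbdd ⟨_, ⟨σ, σ.2, rfl⟩, rfl⟩).trans_eq ?_
  simp

lemma le_typeII_of_relEnt_le {A B : Set (MatC ι)} (hA : ∀ ρ ∈ A, IsState ρ)
    (hB : ∀ σ ∈ B, IsState σ) (μ : Measure ↥B) [IsProbabilityMeasure μ] {n : ℕ} {ρ : MatC ι}
    (hρ : ρ ∈ A) {D K ε w : ℝ} (hK : 0 < K) (hε : 0 ≤ ε)
    (hD : relEnt (tensorPow ρ n) (iidMix μ n) ≤ (D : EReal))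
    (hw : 2 * (ε + w) ≤ 1 - (D + 1) / K) :
    w * Real.exp (-K) ≤ typeII (iidSet A n) (iidSet B n) ε := by
  refine le_csInf ⟨_, 1, Matrix.PosSemidef.one, ?_, fun ρ _ => ?_, rfl⟩ ?_
  · rw [sub_self]
    exact Matrix.PosSemidef.zero
  · simpa using hε
  · rintro _ ⟨E, hE, hE1, hEA, rfl⟩
    have h1 := relEnt_test_bound (tensorPow_isState (hA ρ hρ) n) (iidMix_isState hB μ n) hE hE1
      hK hD
    have h2 := hEA _ ⟨ρ, hρ, rfl⟩
    have h3 := trace_re_iidMix_mul_le hB μ n hE1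
    have h4 := mul_le_mul_of_nonneg_left h3 (Real.exp_pos K).le
    rw [Real.exp_neg, ← div_eq_mul_inv, div_le_iff₀ (Real.exp_pos K), mul_comm _ (Real.exp K)]
    linarith

lemma negLog_le_of_le {x y K : ℝ} (hy : 0 < y) (h : y * Real.exp (-K) ≤ x) :
    negLog x ≤ ((K - Real.log y : ℝ) : EReal) := by
  have h0 : 0 < y * Real.exp (-K) := mul_pos hy (Real.exp_pos _)
  rw [negLog, if_neg (not_le.2 (h0.trans_le h)), EReal.coe_le_coe_iff]
  have := Real.log_le_log h0 h
  rw [Real.log_mul hy.ne' (Real.exp_pos _).ne', Real.log_exp] at this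
  linarith

/-- No test beats the regularised relative entropy to a fixed mixture. -/
lemma steinExponent_le_liminf {A B : Set (MatC ι)} (hA : ∀ ρ ∈ A, IsState ρ)
    (hB : ∀ σ ∈ B, IsState σ) (μ : Measure ↥B) [IsProbabilityMeasure μ] :
    steinExponent (iidSet A) (iidSet B) ≤
      liminf (fun n => cFrac n * ⨅ ρ ∈ A, relEnt (tensorPow ρ n) (iidMix μ n)) atTop := by
  refine EReal.le_of_forall_lt_iff_le.1 fun z hz => ?_
  have hfreq : ∃ᶠ n in atTop, ∃ ρ ∈ A,
      relEnt (tensorPow ρ n) (iidMix μ n) ≤ ((n * z : ℝ) : EReal) := by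
    refine ((frequently_lt_of_liminf_lt (by isBoundedDefault) hz).and_eventually
      (eventually_gt_atTop 0)).mono fun n ⟨h, hn⟩ => ?_
    obtain ⟨ρ, h⟩ := iInf_lt_iff.1 (lt_mul_of_cFrac_mul_lt hn h)
    obtain ⟨hρ, h⟩ := iInf_lt_iff.1 h
    exact ⟨ρ, hρ, h.le⟩
  have hz0 : 0 ≤ z := by
    by_contra! hneg
    obtain ⟨n, ⟨ρ, hρ, hD⟩, hn⟩ := (hfreq.and_eventually
      (tendsto_natCast_atTop_atTop.eventually_gt_atTop (1 / -z))).exists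
    have h1 := neg_one_le_relEnt (tensorPow_isState (hA ρ hρ) n) (iidMix_isState hB μ n) hD
    have h2 := (div_lt_iff₀ (neg_pos.2 hneg)).1 hn
    linarith
  refine EReal.le_of_forall_lt_iff_le.1 fun y hy => ?_
  rw [EReal.coe_lt_coe_iff] at hy
  set η := (y - z) / 2 with hη
  have hη0 : 0 < η := by linarith
  have hy0 : 0 < z + η := by linarith
  set g := η / (z + η) with hg
  have hg0 : 0 < g := div_pos hη0 hy0
  have hg1 : g ≤ 1 := (div_le_one hy0).2 (by linarith)
  refine (iInf₂_le (g / 8) ⟨by positivity, by linarith⟩).trans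
    (liminf_le_of_frequently_le ?_ (by isBoundedDefault))
  have hev1 : ∀ᶠ n : ℕ in atTop, 1 / (z + η) / n < g / 2 :=
    (tendsto_const_div_atTop_nhds_zero_nat _).eventually_lt_const (by positivity)
  have hev2 : ∀ᶠ n : ℕ in atTop, -Real.log (g / 8) / n < η :=
    (tendsto_const_div_atTop_nhds_zero_nat _).eventually_lt_const hη0
  refine (hfreq.and_eventually (hev1.and (hev2.and (eventually_gt_atTop 0)))).mono ?_
  rintro n ⟨⟨ρ, hρ, hD⟩, h1, h2, hn⟩
  have hn' : (0 : ℝ) < n := Nat.cast_pos.2 hn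
  have hK : 0 < (n : ℝ) * (z + η) := mul_pos hn' hy0
  have hw : 2 * (g / 8 + g / 8) ≤ 1 - (n * z + 1) / (n * (z + η)) := by
    have h3 : 1 - (n * z + 1) / (n * (z + η)) = g - 1 / (z + η) / n := by
      rw [hg]
      field_simp
      ring
    rw [h3]
    linarith
  have h4 := negLog_le_of_le (by positivity)
    (le_typeII_of_relEnt_le hA hB μ hρ hK (by positivity) hD hw)
  refine (cFrac_mono n h4).trans ?_
  rw [cFrac, ← EReal.coe_mul, EReal.coe_le_coe_iff]
  have h5 : (n : ℝ)⁻¹ * (n * (z + η) - Real.log (g / 8)) = z + η + -Real.log (g / 8) / n := by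
    field_simp
    ring
  rw [h5]
  linarith

end Converse

section Universal

variable {ι : Type*} [Fintype ι] [DecidableEq ι]

lemma tendsto_log_add_one_div : Tendsto (fun n : ℕ => Real.log (n + 1) / n) atTop (𝓝 0) := by
  have h1 : Tendsto (fun x : ℝ => Real.log x / x) atTop (𝓝 0) :=
    Real.isLittleO_log_id_atTop.tendsto_div_nhds_zero
  have h2 : Tendsto (fun n : ℕ => ((n : ℝ) + 1)) atTop atTop :=
    tendsto_atTop_add_const_right _ _ tendsto_natCast_atTop_atTop
  have h3 : Tendsto (fun n : ℕ => 1 + 1 / (n : ℝ)) atTop (𝓝 (1 + 0)) :=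
    tendsto_const_nhds.add (tendsto_const_div_atTop_nhds_zero_nat 1)
  have h4 := (h1.comp h2).mul h3
  rw [zero_mul] at h4
  refine h4.congr' ?_
  filter_upwards [eventually_gt_atTop 0] with n hn
  have hn' : (0 : ℝ) < n := Nat.cast_pos.2 hn
  have hn1 : (n : ℝ) + 1 ≠ 0 := by positivity
  simp only [Function.comp_apply]
  field_simp

lemma log_polyBound_le (ι : Type*) [Fintype ι] (n : ℕ) : Real.log (polyBound ι n) ≤
    Real.log 3 + (Fintype.card ι * Fintype.card ι : ℕ) * Real.log (n + 1) := by
  have hn : (0 : ℝ) < (n : ℝ) + 1 := by positivity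
  rw [← Real.log_pow, ← Real.log_mul (by norm_num) (by positivity)]
  refine Real.log_le_log (by unfold polyBound; positivity) ?_
  have h1 : (1 : ℝ) ≤ ((n : ℝ) + 1) ^ (Fintype.card ι * Fintype.card ι) :=
    one_le_pow₀ (by linarith [(Nat.cast_nonneg n : (0 : ℝ) ≤ n)])
  rw [polyBound]
  push_cast
  linarith

open scoped Matrix.Norms.L2Operator in
lemma steinExponent_nonneg {A B : Set (MatC ι)} (hA : ∀ ρ ∈ A, IsState ρ)
    (hB : ∀ σ ∈ B, IsState σ) : 0 ≤ steinExponent (iidSet A) (iidSet B) := by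
  have h := le_steinExponent_of_operator (a := 0) hA hB one_pos (Matrix.PosDef.one)
    (fun ρ _ => ?_) (fun σ hσ => ?_)
  · simpa using h
  · rw [matLog_eq_log Matrix.PosDef.one.1, CFC.log_one, Matrix.mul_zero,
      Matrix.trace_zero, Complex.zero_re]
  · rw [Matrix.mul_one, (tensorPow_isState (hB σ hσ) 1).2, Complex.one_re]

/-- A mixing measure that is asymptotically optimal for all numbers of copies. -/
lemma exists_limsup_le_steinExponent {A B : Set (MatC ι)} (hA : ∀ ρ ∈ A, IsState ρ)
    (hA_ne : A.Nonempty) (hA_cl : IsClosed A) (hB : ∀ σ ∈ B, IsState σ) (hB_ne : B.Nonempty)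
    (hB_cl : IsClosed B) : ∃ μ : Measure ↥B, IsProbabilityMeasure μ ∧
      limsup (fun n => cFrac n * ⨅ ρ ∈ A, relEnt (tensorPow ρ n) (iidMix μ n)) atTop ≤
        steinExponent (iidSet A) (iidSet B) := by
  obtain ⟨b, hb⟩ := hB_ne
  rcases eq_or_ne (steinExponent (iidSet A) (iidSet B)) ⊤ with htop | htop
  · exact ⟨Measure.dirac ⟨b, hb⟩, inferInstance, htop ▸ le_top⟩
  obtain ⟨s, hs⟩ : ∃ s : ℝ, steinExponent (iidSet A) (iidSet B) = s :=
    ⟨_, (EReal.coe_toReal htop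
      (ne_of_gt ((EReal.bot_lt_coe 0).trans_le (steinExponent_nonneg hA hB)))).symm⟩
  have hex : ∀ n : ℕ, ∃ σ ∈ convexHull ℝ (iidSet B n), 0 < n → ∃ τ ∈ A, relEnt (tensorPow τ n) σ ≤
      ((n * s + 2 * Real.log (polyBound ι n) + 3 : ℝ) : EReal) := fun n => by
    by_contra! hcon
    have hn : 0 < n := (hcon _ (subset_convexHull ℝ _ ⟨b, hb, rfl⟩)).1
    have h := le_steinExponent hA hA_ne hA_cl hB ⟨b, hb⟩ hB_cl hn fun σ hσ => (hcon σ hσ).2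
    have hn' : (0 : ℝ) < n := Nat.cast_pos.2 hn
    rw [hs, EReal.coe_le_coe_iff, div_le_iff₀ hn'] at h
    linarith
  choose σ hσ hτ using hex
  obtain ⟨μ, c, hμ, hdom⟩ := exists_dominating_measure hB hσ
  refine ⟨μ, hμ, ?_⟩
  rw [hs]
  set k := Fintype.card ι * Fintype.card ι
  have hlim : Tendsto (fun n : ℕ => s + ((2 * Real.log 3 + 3 + c) / n +
      (2 * k + 2) * (Real.log (n + 1) / n))) atTop (𝓝 s) := by
    simpa using tendsto_const_nhds.add ((tendsto_const_div_atTop_nhds_zero_nat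
      (2 * Real.log 3 + 3 + c)).add (tendsto_log_add_one_div.const_mul (2 * (k : ℝ) + 2)))
  rw [← ((continuous_coe_real_ereal.tendsto s).comp hlim).limsup_eq]
  refine limsup_le_limsup ?_
  filter_upwards [eventually_gt_atTop 0] with n hn
  have hn' : (0 : ℝ) < n := Nat.cast_pos.2 hn
  obtain ⟨τ, hτA, hτn⟩ := hτ n hn
  obtain ⟨w, hw0, hw1, hwlog, hpsd⟩ := hdom n
  have h1 := relEnt_le_add_log (tensorPow_isState (hA τ hτA) n)
    (isState_of_mem_convexHull hB (hσ n)).1 (iidMix_isState hB μ n).1 hw0 hw1 hpsd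
  have h2 : relEnt (tensorPow τ n) (iidMix μ n) ≤
      ((n * s + 2 * Real.log (polyBound ι n) + 3 + Real.log w⁻¹ : ℝ) : EReal) :=
    h1.trans (by rw [EReal.coe_add _ (Real.log w⁻¹)]; gcongr)
  refine (cFrac_mono n ((iInf₂_le τ hτA).trans h2)).trans ?_
  rw [cFrac, ← EReal.coe_mul, Function.comp_apply, EReal.coe_le_coe_iff]
  have h3 := log_polyBound_le ι n
  rw [inv_mul_le_iff₀ hn']
  have h4 : (n : ℝ) * (s + ((2 * Real.log 3 + 3 + c) / n +
      (2 * k + 2) * (Real.log (n + 1) / n))) =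
      n * s + (2 * Real.log 3 + 3 + c) + (2 * k + 2) * Real.log (n + 1) := by
    field_simp
    ring
  rw [h4]
  linarith

end Universal

/-- **Composite i.i.d. null versus composite i.i.d. alternative.**
`Stein(𝒜₁^{iid}‖ℬ₁^{iid}) = min*_{μ∈𝒫(ℬ₁)} lim_n (1/n) inf_{ρ∈𝒜₁} D(ρ^{⊗n}‖∫dμ(σ) σ^{⊗n})`. -/
theorem composite_iid_vs_composite_iid (d : ℕ)
    (A1 B1 : Set (MatC (Fin d)))
    (hA_states : ∀ ρ ∈ A1, IsState ρ) (hA_ne : A1.Nonempty) (hA_closed : IsClosed A1)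
    (hB_states : ∀ σ ∈ B1, IsState σ) (hB_ne : B1.Nonempty) (hB_closed : IsClosed B1) :
    ∃ S : EReal,
      steinExponent (iidSet A1) (iidSet B1) = S ∧
      (∃ μ : Measure ↥B1, IsProbabilityMeasure μ ∧
        Filter.Tendsto
          (fun n : ℕ => cFrac n * ⨅ ρ ∈ A1, relEnt (tensorPow ρ n) (iidMix μ n))
          Filter.atTop (nhds S)) ∧
      (∀ μ : Measure ↥B1, IsProbabilityMeasure μ → ∀ L : EReal,
        Filter.Tendsto
          (fun n : ℕ => cFrac n * ⨅ ρ ∈ A1, relEnt (tensorPow ρ n) (iidMix μ n))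
          Filter.atTop (nhds L) → S ≤ L) := by
  obtain ⟨μ, hμ, h⟩ := exists_limsup_le_steinExponent hA_states hA_ne hA_closed hB_states hB_ne
    hB_closed
  refine ⟨_, rfl, ⟨μ, hμ, tendsto_of_le_liminf_of_limsup_le
    (steinExponent_le_liminf hA_states hB_states μ) h⟩, fun ν hν L hL => ?_⟩
  rw [← hL.liminf_eq]
  exact steinExponent_le_liminf hA_states hB_states ν

end QSanov
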